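/- arXiv:2311.08939 — 2 statements merged into one kernel-verified Lean document; each statement's English description precedes it below -/
import Mathlib

section
/- For every integer n ≥ 4, the maximal number of forward alternating monomials in commutator monomials satisfies the exact scaling relation r_{n+4}^forw = 6 · r_n^forw. -/
open scoped Classical

/-- Full plane binary trees with leaves labeled by natural numbers
(representing the variables `X_i`). -/
inductive BTree : Type where
  | leaf : ℕ → BTree
  | node : BTree → BTree → BTree

namespace BTree

/-- The list of leaf labels, from left to right. -/
def leaves : BTree → List ℕ
  | leaf a => [a]
  | node l r => l.leaves ++ r.leaves

/-- The expansion set `W(T, ℓ)` of the commutator monomial modeled by `T`. -/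
def words : BTree → Finset (List ℕ)
  | leaf a => {[a]}
  | node l r =>
      ((l.words ×ˢ r.words).image fun p => p.1 ++ p.2) ∪
      ((l.words ×ˢ r.words).image fun p => p.2 ++ p.1)

end BTree

/-- A word (list of labels) is alternating: consecutive entries differ, and no entry
lies strictly between its two neighbours. -/
def IsAlternating (w : List ℕ) : Prop :=
  (∀ i, i + 1 < w.length → w.getD i 0 ≠ w.getD (i + 1) 0) ∧
  (∀ i, i + 2 < w.length →
    ¬ (w.getD i 0 < w.getD (i + 1) 0 ∧ w.getD (i + 1) 0 < w.getD (i + 2) 0) ∧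
    ¬ (w.getD (i + 2) 0 < w.getD (i + 1) 0 ∧ w.getD (i + 1) 0 < w.getD i 0))

/-- A word is forward alternating: alternating, and it does not start with an ascent. -/
def IsForwardAlternating (w : List ℕ) : Prop :=
  IsAlternating w ∧ (w.length ≤ 1 ∨ w.getD 1 0 < w.getD 0 0)

/-- Number of alternating words in the expansion of `t`. -/
noncomputable def altCount (t : BTree) : ℕ :=
  (t.words.filter fun w => IsAlternating w).card

/-- Number of forward alternating words in the expansion of `t`. -/
noncomputable def faltCount (t : BTree) : ℕ :=
  (t.words.filter fun w => IsForwardAlternating w).card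

/-- `rAlt n` : the maximal number of alternating associative monomials in a commutator
monomial whose leaves are labeled bijectively by `{1, …, n}`. -/
noncomputable def rAlt (n : ℕ) : ℕ :=
  sSup {m | ∃ t : BTree, t.leaves.Perm (List.range' 1 n) ∧ m = altCount t}

/-- `rFAlt n` : the forward-alternating analogue of `rAlt n`. -/
noncomputable def rFAlt (n : ℕ) : ℕ :=
  sSup {m | ∃ t : BTree, t.leaves.Perm (List.range' 1 n) ∧ m = faltCount t}

/-- The number of alternating permutations of `{1, …, n}` (denoted `Ẽ_n`). -/
noncomputable def altPerms (n : ℕ) : ℕ :=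
  Nat.card {σ : Equiv.Perm (Fin n) // IsAlternating (List.ofFn fun i => (σ i : ℕ))}

/-- The number of forward alternating permutations of `{1, …, n}` (denoted `E_n`). -/
noncomputable def faltPerms (n : ℕ) : ℕ :=
  Nat.card {σ : Equiv.Perm (Fin n) // IsForwardAlternating (List.ofFn fun i => (σ i : ℕ))}

namespace AltWords

/-- An end of a typed word: `(true, x)` is a peak of strength `x`, `(false, x)` a valley of
strength `x`; strengths are measured so that larger ends are easier to attach to. -/
abbrev End := Bool × ℕ

/-- A weighted family of typed words, each remembered only through its two ends. -/
abbrev Family := List (ℕ × End × End)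

/-- Whether two ends may be juxtaposed, when labels range over `0, …, M`. -/
def joins (M : ℕ) (a b : End) : Bool := (a.1 != b.1) && Nat.blt M (a.2 + b.2)

/-- Concatenations of a word of `X` with a word of `Y`. -/
def cat (M : ℕ) (X Y : Family) : Family :=
  X.flatMap fun x => (Y.filter fun y => joins M x.2.2 y.2.1).map fun y =>
    (x.1 * y.1, x.2.1, y.2.2)

/-- The two-sided product of families, modelling the commutator. -/
def prod (M : ℕ) (X Y : Family) : Family := cat M X Y ++ cat M Y X

/-- The weighted sum of `f` over a family. -/
def val (f : End → End → ℕ) (X : Family) : ℕ := (X.map fun x => x.1 * f x.2.1 x.2.2).sum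

/-- The end of type `b` at the label `x`. -/
def endAt (M : ℕ) (b : Bool) (x : ℕ) : End := (b, bif b then x else M - x)

/-- The number of (weighted) words with prescribed types and strength bounds. -/
def ind (b : Bool) (p : ℕ) (b' : Bool) (p' : ℕ) (s e : End) : ℕ :=
  if (s.1 = b ∧ p ≤ s.2) ∧ (e.1 = b' ∧ p' ≤ e.2) then 1 else 0

/-- The cone of test functions generated by the indicators `ind`. -/
def Tests : AddSubmonoid (End → End → ℕ) :=
  AddSubmonoid.closure {f | ∃ b p b' p', f = ind b p b' p'}

/-- The functional obtained from `f` by multiplying with the family `Y`. -/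
def star (M : ℕ) (Y : Family) (f : End → End → ℕ) : End → End → ℕ := fun s e =>
  (Y.map fun y => y.1 * ((if joins M e y.2.1 then f s y.2.2 else 0) +
    (if joins M y.2.2 s then f y.2.1 e else 0))).sum

@[simp] lemma val_nil (f) : val f [] = 0 := rfl

@[simp] lemma val_cons (f x X) : val f (x :: X) = x.1 * f x.2.1 x.2.2 + val f X := by
  simp [val]

@[simp] lemma val_append (f X Y) : val f (X ++ Y) = val f X + val f Y := by
  simp [val]

lemma val_mono {f g : End → End → ℕ} (h : ∀ s e, f s e ≤ g s e) (X) : val f X ≤ val g X := by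
  induction X with
  | nil => simp
  | cons x X ih => simp only [val_cons]; gcongr; exact h _ _

lemma val_add (f g : End → End → ℕ) (X) : val (f + g) X = val f X + val g X := by
  induction X with
  | nil => simp
  | cons x X ih => simp only [val_cons, ih, Pi.add_apply]; ring

lemma val_zero (X) : val 0 X = 0 := by
  induction X with
  | nil => simp
  | cons x X ih => simp [ih]

lemma val_smul (c : ℕ) (f : End → End → ℕ) (X) : val (c • f) X = c * val f X := by
  induction X with
  | nil => simp
  | cons x X ih => simp only [val_cons, ih, Pi.smul_apply, smul_eq_mul]; ring

lemma val_cat (M f X Y) :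
    val f (cat M X Y) =
      val (fun s e => val (fun s' e' => if joins M e s' then f s e' else 0) Y) X := by
  induction X with
  | nil => simp [cat]
  | cons x X ih =>
    have h : cat M (x :: X) Y = ((Y.filter fun y => joins M x.2.2 y.2.1).map fun y =>
        (x.1 * y.1, x.2.1, y.2.2)) ++ cat M X Y := by simp [cat]
    rw [h, val_append, ih, val_cons]
    congr 1
    clear h ih
    induction Y with
    | nil => simp
    | cons y Y ih =>
      by_cases hj : joins M x.2.2 y.2.1
      · simp only [List.filter_cons, hj, if_true, List.map_cons, val_cons, ih]; ring
      · simpa only [List.filter_cons, hj, val_cons, mul_zero, zero_add, if_false,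
          Bool.false_eq_true] using ih

lemma val_comm (f : End → End → End → End → ℕ) (X Y : Family) :
    val (fun s e => val (f s e) Y) X = val (fun s' e' => val (fun s e => f s e s' e') X) Y := by
  induction X with
  | nil => simp; exact (val_zero Y).symm
  | cons x X ih =>
    simp only [val_cons, ih]
    rw [← val_smul, ← val_add]
    rfl

lemma val_prod (M f X Y) : val f (prod M X Y) = val (star M Y f) X := by
  rw [prod, val_append, val_cat, val_cat, val_comm _ Y X, ← val_add]
  congr 1
  funext s e
  simp only [Pi.add_apply, star]
  induction Y with
  | nil => simp
  | cons y Y ih => simp only [val_cons, List.map_cons, List.sum_cons, ← ih]; ring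

lemma val_prod_comm (M f X Y) : val f (prod M X Y) = val f (prod M Y X) := by
  rw [prod, prod, val_append, val_append, add_comm]

lemma ind_mem_tests (b p b' p') : ind b p b' p' ∈ Tests :=
  AddSubmonoid.subset_closure ⟨b, p, b', p', rfl⟩

lemma star_mem_tests (M Y) {f} (hf : f ∈ Tests) : star M Y f ∈ Tests := by
  induction hf using AddSubmonoid.closure_induction with
  | zero =>
    have : star M Y 0 = 0 := by funext s e; simp [star]
    rw [this]; exact zero_mem _
  | add f g _ _ hf hg =>
    have : star M Y (f + g) = star M Y f + star M Y g := by
      funext s e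
      simp only [star, Pi.add_apply, ← List.sum_map_add]
      congr 2
      funext y
      split_ifs <;> ring
    rw [this]; exact add_mem hf hg
  | mem f hf =>
    obtain ⟨b, p, b', p', rfl⟩ := hf
    induction Y with
    | nil =>
      have : star M [] (ind b p b' p') = 0 := by funext s e; simp [star]
      rw [this]; exact zero_mem _
    | cons y Y ih =>
      have : star M (y :: Y) (ind b p b' p') =
          y.1 • ((if y.2.2.1 = b' ∧ p' ≤ y.2.2.2 then ind b p (!y.2.1.1) (M + 1 - y.2.1.2) else 0) +
            (if y.2.1.1 = b ∧ p ≤ y.2.1.2 then ind (!y.2.2.1) (M + 1 - y.2.2.2) b' p' else 0)) +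
          star M Y (ind b p b' p') := by
        funext s e
        simp only [star, List.map_cons, List.sum_cons, Pi.add_apply, Pi.smul_apply, smul_eq_mul]
        congr 2
        congr 1
        · have : joins M e y.2.1 = true ↔ e.1 = !y.2.1.1 ∧ M + 1 - y.2.1.2 ≤ e.2 := by
            simp only [joins, Bool.and_eq_true, bne_iff_ne, Nat.blt_eq]
            constructor <;> rintro ⟨h1, h2⟩ <;> refine ⟨?_, by omega⟩
            · revert h1; cases e.1 <;> cases y.2.1.1 <;> simp
            · rw [h1]; simp
          simp only [this, ind]
          split_ifs <;> simp_all [ind]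
        · have : joins M y.2.2 s = true ↔ s.1 = !y.2.2.1 ∧ M + 1 - y.2.2.2 ≤ s.2 := by
            simp only [joins, Bool.and_eq_true, bne_iff_ne, Nat.blt_eq]
            constructor <;> rintro ⟨h1, h2⟩ <;> refine ⟨?_, by omega⟩
            · revert h1; cases s.1 <;> cases y.2.2.1 <;> simp
            · rw [h1]; simp
          simp only [this, ind]
          split_ifs <;> simp_all [ind]
      rw [this]
      refine add_mem (nsmul_mem (add_mem ?_ ?_) _) ih
      · split_ifs
        exacts [ind_mem_tests _ _ _ _, zero_mem _]
      · split_ifs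
        exacts [ind_mem_tests _ _ _ _, zero_mem _]

/-- A family is symmetric if it is invariant under reversal of words. -/
def Symm (X : Family) : Prop := ∀ f, val f X = val (fun s e => f e s) X

lemma joins_comm (M a b) : joins M a b = joins M b a := by
  simp only [joins, add_comm a.2, bne_comm (a := a.1)]

lemma Symm.prod {X Y} (M) (hX : Symm X) (hY : Symm Y) : Symm (prod M X Y) := by
  have key : ∀ f {X Y}, Symm X → Symm Y →
      val f (cat M X Y) = val (fun s e => f e s) (cat M Y X) := by
    intro f X Y hX hY
    rw [val_cat, val_cat, hX, val_comm _ Y X]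
    congr 1
    funext s e
    rw [hY]
    simp only [joins_comm M]
  intro f
  rw [AltWords.prod, val_append, val_append, key f hX hY, key f hY hX, add_comm]

/-- Symmetrization of a family. -/
def mir (X : Family) : Family := X ++ X.map fun x => (x.1, x.2.2, x.2.1)

lemma symm_mir (X) : Symm (mir X) := by
  intro f
  have : ∀ f, val f (X.map fun x => (x.1, x.2.2, x.2.1)) = val (fun s e => f e s) X := by
    intro f
    simp [val, Function.comp_def]
  rw [mir, val_append, val_append, this, this, add_comm]

/-- Shapes of generators with one parameter. -/
inductive Shape₁ | l | s | k | q

/-- Shapes of generators with two parameters; the flag distinguishes a shape from its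
complement. -/
inductive Shape₂ | b | y (t : Bool) | a (t : Bool) | d (t : Bool) | e (t : Bool)

/-- The families to which all commutator monomials are compared. -/
inductive Gen
  | c
  | one (σ : Shape₁) (x : ℕ)
  | two (σ : Shape₂) (x y : ℕ)

namespace Gen

/-- The number of leaves attributed to a generator. -/
def size : Gen → ℕ
  | c => 2
  | one .l _ => 1
  | one .s _ => 3
  | one .k _ => 5
  | one .q _ => 11
  | two .b _ _ => 6
  | two (.y _) _ _ => 4
  | two (.a _) _ _ => 6
  | two (.d _) _ _ => 7
  | two (.e _) _ _ => 8

/-- The parameters are ordered and bounded by `M`. -/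
def Valid (M : ℕ) : Gen → Prop
  | c => True
  | one _ x => x ≤ M
  | two _ x y => x ≤ y ∧ y ≤ M

instance (M : ℕ) : (g : Gen) → Decidable (g.Valid M)
  | c => inferInstanceAs (Decidable True)
  | one _ x => inferInstanceAs (Decidable (x ≤ M))
  | two _ x y => inferInstanceAs (Decidable (x ≤ y ∧ y ≤ M))

/-- Relabeling of the parameters. -/
def map (τ : ℕ → ℕ) : Gen → Gen
  | c => c
  | one σ x => one σ (τ x)
  | two σ x y => two σ (τ x) (τ y)

/-- Two-parameter generators: `x` is the extreme parameter on the side given by `t`. -/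
def twoFamily (M : ℕ) : Shape₂ → ℕ → ℕ → Family
  | .b, x, y =>
    [(1, endAt M true x, (false, M)), (1, endAt M true x, endAt M false y),
      (1, (true, M), endAt M false y), (1, endAt M true y, (false, M)),
      (1, endAt M true y, endAt M false x), (1, (true, M), (false, M)),
      (1, (true, M), endAt M false x)]
  | .y t, x, y =>
    [(1, endAt M t x, endAt M (!t) y), (1, (t, M), endAt M (!t) y),
      (1, endAt M t y, endAt M (!t) x)]
  | .a t, x, y =>
    [(1, endAt M t x, endAt M (!t) y), (3, (t, M), endAt M (!t) y),
      (1, endAt M t y, endAt M (!t) x), (2, endAt M t y, (!t, M))]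
  | .d t, x, y =>
    [(3, endAt M t x, (t, M)), (4, endAt M t x, endAt M t y),
      (1, endAt M (!t) x, (!t, M)), (2, endAt M (!t) x, endAt M (!t) y)]
  | .e t, x, y =>
    [(7, endAt M t x, endAt M (!t) y), (7, (t, M), endAt M (!t) y),
      (1, endAt M t y, endAt M (!t) x)]

/-- Whether the larger parameter of a two-parameter generator is listed first. -/
def desc : Shape₂ → Bool
  | .b => false
  | .y t => t
  | .a t => t
  | .d t => t
  | .e t => t

/-- The family of a generator. -/
def family (M : ℕ) : Gen → Family
  | c => mir [(1, (true, M), (false, M))]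
  | one .l x => [(1, endAt M true x, endAt M true x), (1, endAt M false x, endAt M false x)]
  | one .s x => mir [(1, endAt M true x, (true, M)), (1, endAt M false x, (false, M))]
  | one .k x =>
    mir [(1, endAt M true x, (true, M)), (1, (true, M), (true, M)),
      (1, endAt M false x, (false, M)), (1, (false, M), (false, M))]
  | one .q x =>
    mir [(15, endAt M true x, (true, M)), (14, (true, M), (true, M)),
      (15, endAt M false x, (false, M)), (14, (false, M), (false, M))]
  | two σ x y => mir (bif desc σ then twoFamily M σ y x else twoFamily M σ x y)

lemma symm_family (M g) : Symm (family M g) := by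
  rcases g with _ | ⟨_ | _ | _ | _, x⟩ | ⟨s, x, y⟩
  case one.l => intro f; simp [family]
  all_goals exact symm_mir _

end Gen

/-- The transport of ends along a map of labels. -/
def endMap (K M : ℕ) (τ : ℕ → ℕ) (a : End) : End := (a.1, bif a.1 then τ a.2 else M - τ (K - a.2))

/-- The transport of families along a map of labels. -/
def famMap (K M : ℕ) (τ : ℕ → ℕ) (X : Family) : Family :=
  X.map fun x => (x.1, endMap K M τ x.2.1, endMap K M τ x.2.2)

/-- All strengths occurring in a family are at most `K`. -/
def Bdd (K : ℕ) (X : Family) : Prop := ∀ x ∈ X, x.2.1.2 ≤ K ∧ x.2.2.2 ≤ K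

lemma val_famMap (K M τ f X) :
    val f (famMap K M τ X) = val (fun s e => f (endMap K M τ s) (endMap K M τ e)) X := by
  simp [val, famMap, Function.comp_def]

lemma famMap_mir (K M τ X) : famMap K M τ (mir X) = mir (famMap K M τ X) := by
  simp [famMap, mir, Function.comp_def]

lemma Bdd.mir {K X} (h : Bdd K X) : Bdd K (mir X) := by
  intro x hx
  rw [AltWords.mir, List.mem_append, List.mem_map] at hx
  obtain hx | ⟨y, hy, rfl⟩ := hx
  · exact h x hx
  · exact ⟨(h y hy).2, (h y hy).1⟩

lemma Bdd.cat {K X Y} (M) (hX : Bdd K X) (hY : Bdd K Y) : Bdd K (cat M X Y) := by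
  intro z hz
  simp only [AltWords.cat, List.mem_flatMap, List.mem_map, List.mem_filter] at hz
  obtain ⟨x, hx, y, ⟨hy, _⟩, rfl⟩ := hz
  exact ⟨(hX x hx).1, (hY y hy).2⟩

lemma Bdd.prod {K X Y} (M) (hX : Bdd K X) (hY : Bdd K Y) : Bdd K (prod M X Y) := by
  intro z hz
  obtain hz | hz := List.mem_append.1 hz
  exacts [hX.cat M hY z hz, hY.cat M hX z hz]

lemma endAt_le {M x} (b) (h : x ≤ M) : (endAt M b x).2 ≤ M := by
  cases b <;> simp [endAt, h]

lemma Gen.Valid.bdd {M} {g : Gen} (h : g.Valid M) : Bdd M (g.family M) := by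
  rcases g with _ | ⟨_ | _ | _ | _, x⟩ | ⟨s, x, y⟩
  case c => intro x hx; simp [family, AltWords.mir] at hx; rcases hx with rfl | rfl <;> simp
  case one.l =>
    intro z hz
    simp only [family, List.mem_cons, List.not_mem_nil, or_false] at hz
    rcases hz with rfl | rfl <;> simp [endAt_le _ (show x ≤ M from h)]
  case two =>
    obtain ⟨hxy, hy⟩ := h
    have : ∀ x y, x ≤ M → y ≤ M → Bdd M (twoFamily M s x y) := by
      intro x y hx hy z hz
      cases s <;> simp only [twoFamily, List.mem_cons, List.not_mem_nil, or_false] at hz <;>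
        rcases hz with rfl | rfl | rfl | rfl | rfl | rfl | rfl <;>
        simp [endAt_le _ hx, endAt_le _ hy]
    rw [family]
    refine Bdd.mir ?_
    cases desc s
    exacts [this _ _ (hxy.trans hy) hy, this _ _ hy (hxy.trans hy)]
  all_goals
    refine Bdd.mir fun z hz => ?_
    simp only [List.mem_cons, List.not_mem_nil, or_false] at hz
    rcases hz with rfl | rfl | rfl | rfl <;> simp [endAt_le _ (show x ≤ M from h)]

section Transport

variable {K M : ℕ} {τ : ℕ → ℕ}

lemma endMap_endAt (b) {x} (hx : x ≤ K) :
    endMap K M τ (endAt K b x) = endAt M b (τ x) := by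
  cases b <;> simp [endMap, endAt, Nat.sub_sub_self hx]

lemma endMap_top (h0 : τ 0 = 0) (hK : τ K = M) (b) : endMap K M τ (b, K) = (b, M) := by
  cases b <;> simp [endMap, h0, hK]

lemma family_map (h0 : τ 0 = 0) (hK : τ K = M) {g : Gen} (hg : g.Valid K) :
    (g.map τ).family M = famMap K M τ (g.family K) := by
  rcases g with _ | ⟨_ | _ | _ | _, x⟩ | ⟨s, x, y⟩
  case c =>
    simp only [Gen.map, Gen.family, famMap_mir]
    simp [famMap, endMap_top h0 hK]
  case one.l =>
    have hx : x ≤ K := hg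
    simp [Gen.map, Gen.family, famMap, endMap_endAt, hx]
  case two =>
    obtain ⟨hxy, hy⟩ := hg
    have : ∀ x y, x ≤ K → y ≤ K →
        Gen.twoFamily M s (τ x) (τ y) = famMap K M τ (Gen.twoFamily K s x y) := by
      intro x y hx hy
      cases s <;> simp [Gen.twoFamily, famMap, endMap_top h0 hK, endMap_endAt, hx, hy]
    rw [Gen.map, Gen.family, Gen.family, famMap_mir]
    cases Gen.desc s
    · simp [this _ _ (hxy.trans hy) hy]
    · simp [this _ _ hy (hxy.trans hy)]
  all_goals
    have hx : x ≤ K := hg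
    simp only [Gen.map, Gen.family, famMap_mir]
    simp [famMap, endMap_endAt, hx, endMap_top h0 hK]

lemma Gen.Valid.map (hτ : Monotone τ) (hK : τ K = M) {g : Gen} (hg : g.Valid K) :
    (g.map τ).Valid M := by
  subst hK
  cases g with
  | c => trivial
  | one σ x => exact hτ hg
  | two σ x y => exact ⟨hτ hg.1, hτ hg.2⟩

lemma joins_endMap (hτ : Monotone τ) (hK : τ K = M) {a b : End} (ha : a.2 ≤ K) (hb : b.2 ≤ K)
    (h : joins M (endMap K M τ a) (endMap K M τ b)) : joins K a b := by
  obtain ⟨ta, a⟩ := a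
  obtain ⟨tb, b⟩ := b
  simp only [joins, endMap, Bool.and_eq_true, bne_iff_ne, Nat.blt_eq] at h ⊢
  refine ⟨h.1, ?_⟩
  by_contra hle
  have hle : a + b ≤ K := not_lt.1 hle
  obtain ⟨h1, h2⟩ := h
  cases ta <;> cases tb <;> simp only [ne_eq, not_true_eq_false] at h1
  · have := hτ (show b ≤ K - a by omega)
    have := hτ (show K - a ≤ K by omega)
    simp only [cond_false, cond_true] at h2
    omega
  · have := hτ (show a ≤ K - b by omega)
    have := hτ (show K - b ≤ K by omega)
    simp only [cond_false, cond_true] at h2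
    omega

lemma val_mono_of_bdd {f g : End → End → ℕ} {X} (hX : Bdd K X)
    (h : ∀ s e : End, s.2 ≤ K → e.2 ≤ K → f s e ≤ g s e) : val f X ≤ val g X := by
  induction X with
  | nil => simp
  | cons x X ih =>
    simp only [val_cons]
    have := hX x (by simp)
    exact add_le_add (Nat.mul_le_mul_left _ (h _ _ this.1 this.2))
      (ih fun y hy => hX y (by simp [hy]))

lemma val_prod_famMap_le (hτ : Monotone τ) (hK : τ K = M) (f) {X Y} (hX : Bdd K X)
    (hY : Bdd K Y) :
    val f (prod M (famMap K M τ X) (famMap K M τ Y)) ≤ val f (famMap K M τ (prod K X Y)) := by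
  have key : ∀ {X Y}, Bdd K X → Bdd K Y → val f (cat M (famMap K M τ X) (famMap K M τ Y)) ≤
      val (fun s e => f (endMap K M τ s) (endMap K M τ e)) (cat K X Y) := by
    intro X Y hX hY
    rw [val_cat, val_cat, val_famMap]
    refine val_mono_of_bdd hX fun s e hs he => ?_
    rw [val_famMap]
    refine val_mono_of_bdd hY fun s' e' hs' he' => ?_
    by_cases h : joins M (endMap K M τ e) (endMap K M τ s')
    · simp [h, joins_endMap hτ hK he hs' h]
    · simp [h]
  rw [val_famMap, prod, prod, val_append, val_append]
  exact add_le_add (key hX hY) (key hY hX)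

/-- Domination of families by all indicators passes to transported test functions. -/
lemma val_endMap_le (hτ : Monotone τ) {f} (hf : f ∈ Tests) {N : ℕ} {X Y : Family}
    (hX : Bdd K X) (hY : Bdd K Y)
    (h : ∀ b p b' p', N * val (ind b p b' p') X ≤ val (ind b p b' p') Y) :
    N * val (fun s e => f (endMap K M τ s) (endMap K M τ e)) X ≤
      val (fun s e => f (endMap K M τ s) (endMap K M τ e)) Y := by
  have thr : ∀ b p, ∃ p', ∀ u ≤ K, (p ≤ (endMap K M τ (b, u)).2 ↔ p' ≤ u) := by
    intro b p
    have hmono : ∀ u v, u ≤ v → v ≤ K →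
        (endMap K M τ (b, u)).2 ≤ (endMap K M τ (b, v)).2 := by
      intro u v huv hv
      cases b
      · have := hτ (show K - v ≤ K - u by omega)
        simp only [endMap, cond_false]; omega
      · exact hτ huv
    classical
    by_cases hex : ∃ u, u ≤ K ∧ p ≤ (endMap K M τ (b, u)).2
    · refine ⟨Nat.find hex, fun u hu => ⟨fun h => Nat.find_min' hex ⟨hu, h⟩, fun h => ?_⟩⟩
      exact (Nat.find_spec hex).2.trans (hmono _ _ h hu)
    · refine ⟨K + 1, fun u hu => ⟨fun h => absurd ⟨u, hu, h⟩ hex, fun h => by omega⟩⟩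
  induction hf using AddSubmonoid.closure_induction with
  | zero => simp [val]
  | add f g _ _ hf hg =>
    have := add_le_add hf hg
    rw [← mul_add, ← val_add, ← val_add] at this
    exact this
  | mem f hf =>
    obtain ⟨b, p, b', p', rfl⟩ := hf
    obtain ⟨q, hq⟩ := thr b p
    obtain ⟨q', hq'⟩ := thr b' p'
    have : ∀ s e : End, s.2 ≤ K → e.2 ≤ K →
        ind b p b' p' (endMap K M τ s) (endMap K M τ e) = ind b q b' q' s e := by
      rintro ⟨t, u⟩ ⟨t', u'⟩ hu hu'
      simp only [ind]
      congr 1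
      apply propext
      constructor
      · rintro ⟨⟨h1, h2⟩, h3, h4⟩
        simp only [endMap] at h1 h3
        subst h1 h3
        exact ⟨⟨rfl, (hq u hu).1 h2⟩, rfl, (hq' u' hu').1 h4⟩
      · rintro ⟨⟨h1, h2⟩, h3, h4⟩
        subst h1 h3
        exact ⟨⟨rfl, (hq u hu).2 h2⟩, rfl, (hq' u' hu').2 h4⟩
    calc _ ≤ N * val (ind b q b' q') X :=
          Nat.mul_le_mul_left _ (val_mono_of_bdd hX fun s e hs he => (this s e hs he).le)
      _ ≤ val (ind b q b' q') Y := h _ _ _ _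
      _ ≤ _ := val_mono_of_bdd hY fun s e hs he => (this s e hs he).ge

end Transport

/-- The maximal growth of commutator monomials, `3, 7, 18, 42, 108, …`. -/
def growth : ℕ → ℕ
  | 0 => 3
  | 1 => 7
  | k + 2 => 6 * growth k

lemma growth_mul_le (j k : ℕ) : growth j * growth k ≤ 3 * growth (j + k) := by
  induction j using growth.induct with
  | case1 => simp [growth]
  | case2 =>
    induction k using growth.induct with
    | case1 => simp [growth]
    | case2 => simp [growth]
    | case3 k ih =>
      rw [show 1 + (k + 1 + 1) = 1 + k + 2 by ring]
      simp only [growth] at ih ⊢; linarith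
  | case3 j ih =>
    rw [show j + 2 + k = j + k + 2 by ring]
    simp only [growth]; linarith

namespace Gen

/-- The generator obtained by reversing the order of the labels `0, …, K`. -/
def comp (K : ℕ) : Gen → Gen
  | c => c
  | one σ x => one σ (K - x)
  | two .b x y => two .b (K - y) (K - x)
  | two (.y t) x y => two (.y !t) (K - y) (K - x)
  | two (.a t) x y => two (.a !t) (K - y) (K - x)
  | two (.d t) x y => two (.d !t) (K - y) (K - x)
  | two (.e t) x y => two (.e !t) (K - y) (K - x)

/-- A numerical code of generators with small parameters. -/
def code : Gen → ℕ
  | c => 0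
  | one .l x => 100 + x
  | one .s x => 200 + x
  | one .k x => 300 + x
  | one .q x => 400 + x
  | two .b x y => 500 + 10 * x + y
  | two (.y t) x y => (bif t then 600 else 700) + 10 * x + y
  | two (.a t) x y => (bif t then 800 else 900) + 10 * x + y
  | two (.d t) x y => (bif t then 1000 else 1100) + 10 * x + y
  | two (.e t) x y => (bif t then 1200 else 1300) + 10 * x + y

end Gen

/-- Certificates `(N, [(c₁, V₁), …])` for `N • [V, W]` being dominated by `∑ cᵢ • Vᵢ`, listed by
`V` and `W`. -/
def certTable : List (Gen × List (Gen × ℕ × List (ℕ × Gen))) := [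
    (.one .l 1, [
      (.c, 1, [(1, .one .s 1)]),
      (.one .s 2, 1, [(1, .two (.y true) 1 2)]),
      (.one .k 2, 1, [(1, .two (.a true) 1 2)]),
      (.two .b 2 3, 2, [(1, .two (.d false) 1 2), (1, .two (.d false) 1 3)]),
      (.one .q 2, 5, [(112, .c), (28, .two (.y true) 1 1), (75, .two (.y true) 1 2),
        (28, .two (.y false) 1 1)]),
      (.two (.y true) 2 3, 1, [(6, .one .l 0)]),
      (.two (.a true) 2 3, 1, [(10, .one .l 0), (2, .one .l 1), (2, .one .l 2)]),
      (.two (.d true) 2 3, 7, [(4, .two (.e true) 1 2), (3, .two (.e true) 1 3)]),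
      (.two (.e true) 2 3, 1, [(30, .one .l 0)])]),
    (.one .l 2, [
      (.one .s 1, 1, [(1, .two (.y false) 1 2)]),
      (.one .k 1, 1, [(1, .two (.a false) 1 2)]),
      (.two .b 1 3, 1, [(1, .one .l 1), (2, .one .l 2), (1, .one .l 3), (3, .one .s 2)]),
      (.one .q 1, 5, [(112, .c), (28, .two (.y true) 2 2), (75, .two (.y false) 1 2),
        (28, .two (.y false) 2 2)]),
      (.two (.y true) 1 3, 1, [(2, .one .l 0), (2, .one .l 2), (1, .one .l 3), (1, .one .l 4)]),
      (.two (.a true) 1 3, 1, [(4, .one .l 2), (1, .one .l 3), (3, .one .l 4), (2, .one .s 1)]),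
      (.two (.e true) 1 3, 1, [(14, .one .s 2)])]),
    (.one .l 3, [
      (.two .b 1 2, 2, [(1, .two (.d true) 1 3), (1, .two (.d true) 2 3)]),
      (.two (.y true) 1 2, 1, [(1, .one .l 1), (1, .one .l 2), (3, .one .l 3), (1, .one .l 4)]),
      (.two (.a true) 1 2, 1, [(3, .one .l 1), (1, .one .l 2), (7, .one .l 3), (3, .one .l 4)]),
      (.two (.e true) 1 2, 1, [(6, .one .l 0), (1, .one .l 1), (7, .one .l 2), (15, .one .l 3),
        (7, .one .l 4)])]),
    (.c, [
      (.one .s 1, 1, [(1, .one .k 1)]),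
      (.one .k 1, 1, [(4, .one .l 0), (4, .one .l 2), (1, .one .k 1)]),
      (.one .q 1, 1, [(86, .one .l 0), (86, .one .l 2), (15, .one .s 1)]),
      (.two (.d true) 1 2, 1, [(7, .one .l 0), (4, .one .l 1), (7, .one .l 2), (17, .one .l 3)])]),
    (.one .s 1, [
      (.one .s 2, 1, [(1, .two .b 1 2)]),
      (.one .k 2, 1, [(8, .c), (1, .two .b 1 2)]),
      (.two .b 2 3, 1, [(15, .one .l 0), (7, .one .l 1), (3, .one .l 2), (3, .one .l 3),
        (7, .one .l 4)]),
      (.one .q 2, 1, [(112, .c), (15, .two .b 1 2)]),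
      (.two (.y true) 2 3, 1, [(7, .one .l 0), (3, .one .l 1), (1, .one .l 2), (1, .one .l 3),
        (1, .one .l 4)]),
      (.two (.a true) 2 3, 1, [(15, .one .l 0), (7, .one .l 1), (5, .one .l 2), (1, .one .l 3),
        (5, .one .l 4)]),
      (.two (.e true) 2 3, 1, [(7, .one .s 1), (2, .one .s 3), (3, .two (.d false) 1 2)])]),
    (.one .s 2, [
      (.one .s 1, 1, [(1, .two .b 1 2)]),
      (.one .k 1, 1, [(8, .c), (1, .two .b 1 2)]),
      (.two .b 1 3, 1, [(11, .one .l 0), (3, .one .l 1), (7, .one .l 2), (4, .one .l 3),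
        (10, .one .l 4)]),
      (.one .q 1, 1, [(112, .c), (15, .two .b 1 2)]),
      (.two (.y true) 1 3, 1, [(2, .one .s 2), (1, .one .s 3), (1, .one .k 1)]),
      (.two (.a true) 1 3, 1, [(9, .one .l 0), (5, .one .l 1), (7, .one .l 2), (2, .one .l 3),
        (12, .one .l 4)]),
      (.two (.e true) 1 3, 15, [(17, .one .s 2), (15, .one .s 3), (1, .one .q 1),
        (13, .one .q 2)])]),
    (.one .s 3, [
      (.two .b 1 2, 1, [(7, .one .l 0), (4, .one .l 1), (4, .one .l 2), (7, .one .l 3),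
        (13, .one .l 4)]),
      (.two (.y true) 1 2, 1, [(2, .one .l 2), (2, .one .l 3), (4, .one .l 4), (2, .one .s 1)]),
      (.two (.a true) 1 2, 1, [(6, .one .l 0), (6, .one .l 1), (2, .one .l 2), (7, .one .l 3),
        (13, .one .l 4)]),
      (.two (.e true) 1 2, 1, [(10, .one .l 0), (7, .one .l 3), (21, .one .l 4), (2, .one .s 1),
        (14, .one .s 2)])]),
    (.one .k 1, [
      (.two .b 2 3, 1, [(35, .one .l 0), (7, .one .l 1), (7, .one .l 2), (7, .one .l 3),
        (27, .one .l 4)]),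
      (.two (.y true) 2 3, 1, [(15, .one .l 0), (3, .one .l 1), (3, .one .l 2), (3, .one .l 3),
        (9, .one .l 4)]),
      (.two (.a true) 2 3, 1, [(35, .one .l 0), (7, .one .l 1), (11, .one .l 2), (3, .one .l 3),
        (25, .one .l 4)]),
      (.two (.e true) 2 3, 1, [(24, .one .l 0), (18, .one .k 1), (2, .one .k 2), (4, .one .k 3)])]),
    (.one .k 2, [
      (.two .b 1 3, 1, [(31, .one .l 0), (7, .one .l 1), (7, .one .l 2), (8, .one .l 3),
        (30, .one .l 4)]),
      (.two (.y true) 1 3, 1, [(13, .one .l 0), (3, .one .l 1), (3, .one .l 2), (4, .one .l 3),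
        (12, .one .l 4)]),
      (.two (.a true) 1 3, 1, [(29, .one .l 0), (11, .one .l 1), (7, .one .l 2), (4, .one .l 3),
        (32, .one .l 4)]),
      (.two (.e true) 1 3, 1, [(18, .one .l 3), (13, .one .k 1), (14, .one .k 2), (4, .one .k 3)])]),
    (.one .k 3, [
      (.two .b 1 2, 1, [(27, .one .l 0), (8, .one .l 1), (8, .one .l 2), (7, .one .l 3),
        (33, .one .l 4)]),
      (.two (.y true) 1 2, 1, [(10, .one .l 0), (4, .one .l 1), (4, .one .l 2), (3, .one .l 3),
        (13, .one .l 4)]),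
      (.two (.a true) 1 2, 1, [(26, .one .l 0), (12, .one .l 1), (4, .one .l 2), (7, .one .l 3),
        (33, .one .l 4)]),
      (.two (.e true) 1 2, 1, [(11, .one .l 2), (14, .one .l 3), (9, .one .k 1), (18, .one .k 2)])]),
    (.two .b 1 2, [
      (.one .q 3, 1, [(385, .one .l 0), (116, .one .l 1), (116, .one .l 2), (105, .one .l 3),
        (475, .one .l 4)]),
      (.two (.d true) 3 4, 1, [(11, .one .l 0), (28, .one .l 1), (28, .one .l 2), (28, .one .l 3),
        (49, .one .l 4), (63, .one .l 5)])]),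
    (.two .b 1 3, [
      (.one .q 2, 1, [(445, .one .l 0), (101, .one .l 1), (105, .one .l 2), (116, .one .l 3),
        (430, .one .l 4)]),
      (.two (.d true) 2 4, 1, [(13, .one .l 0), (24, .one .l 1), (28, .one .l 2), (28, .one .l 3),
        (41, .one .l 4), (59, .one .l 5)])]),
    (.two .b 2 3, [
      (.one .q 1, 1, [(505, .one .l 0), (105, .one .l 1), (101, .one .l 2), (101, .one .l 3),
        (385, .one .l 4)]),
      (.two (.d true) 1 4, 1, [(15, .one .l 0), (28, .one .l 1), (24, .one .l 2), (24, .one .l 3),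
        (33, .one .l 4), (55, .one .l 5)])]),
    (.two .b 1 4, [
      (.two (.d true) 2 3, 1, [(18, .one .l 0), (17, .one .l 1), (20, .one .l 2), (41, .one .l 3),
        (28, .one .l 4), (46, .one .l 5)])]),
    (.two .b 2 4, [
      (.two (.d true) 1 3, 1, [(20, .one .l 0), (20, .one .l 1), (17, .one .l 2), (33, .one .l 3),
        (24, .one .l 4), (42, .one .l 5)])]),
    (.two .b 3 4, [
      (.two (.d true) 1 2, 1, [(27, .one .l 0), (12, .one .l 1), (33, .one .l 2), (17, .one .l 3),
        (17, .one .l 4), (29, .one .l 5)])]),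
    (.one .q 1, [
      (.two (.y true) 2 3, 1, [(217, .one .l 0), (45, .one .l 1), (43, .one .l 2),
        (43, .one .l 3), (127, .one .l 4)]),
      (.two (.a true) 2 3, 1, [(505, .one .l 0), (105, .one .l 1), (159, .one .l 2),
        (43, .one .l 3), (355, .one .l 4)]),
      (.two (.e true) 2 3, 1, [(404, .one .l 0), (248, .one .k 1), (28, .one .k 2),
        (58, .one .k 3)])]),
    (.one .q 2, [
      (.two (.y true) 1 3, 1, [(30, .one .s 2), (43, .one .s 3), (43, .one .k 1)]),
      (.two (.a true) 1 3, 1, [(415, .one .l 0), (159, .one .l 1), (105, .one .l 2),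
        (58, .one .l 3), (460, .one .l 4)]),
      (.two (.e true) 1 3, 1, [(256, .one .l 3), (174, .one .k 1), (210, .one .k 2),
        (46, .one .k 3)])]),
    (.one .q 3, [
      (.two (.y true) 1 2, 1, [(142, .one .l 0), (58, .one .l 1), (58, .one .l 2),
        (45, .one .l 3), (187, .one .l 4)]),
      (.two (.a true) 1 2, 1, [(370, .one .l 0), (174, .one .l 1), (58, .one .l 2),
        (105, .one .l 3), (475, .one .l 4)]),
      (.two (.e true) 1 2, 1, [(151, .one .l 2), (210, .one .l 3), (121, .one .k 1),
        (256, .one .k 2)])]),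
    (.two (.y true) 1 2, [
      (.two (.d true) 3 4, 1, [(3, .one .l 1), (14, .one .l 2), (12, .one .l 3), (21, .one .l 4),
        (20, .one .l 5), (1, .two (.d true) 1 1)]),
      (.two (.d false) 3 4, 1, [(15, .one .l 0), (6, .one .l 1), (6, .one .l 2), (9, .one .l 3),
        (6, .one .l 4), (9, .one .l 5)])]),
    (.two (.y true) 1 3, [
      (.two (.d true) 2 4, 1, [(1, .one .l 0), (10, .one .l 1), (12, .one .l 2), (14, .one .l 3),
        (17, .one .l 4), (23, .one .l 5)]),
      (.two (.d false) 2 4, 1, [(32, .one .l 0), (3, .one .l 1), (9, .one .l 2), (6, .one .l 3),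
        (4, .one .l 4), (8, .one .l 5)])]),
    (.two (.y true) 1 4, [
      (.two (.d true) 2 3, 1, [(14, .one .l 3), (10, .one .l 4), (16, .one .l 5), (3, .one .s 1),
        (8, .one .s 2)]),
      (.two (.d false) 2 3, 1, [(47, .one .l 0), (1, .one .l 1), (7, .one .l 2), (4, .one .l 3),
        (6, .one .l 4), (8, .one .l 5)])]),
    (.two (.y true) 2 3, [
      (.two (.d true) 1 4, 1, [(1, .one .l 0), (12, .one .l 1), (10, .one .l 2), (10, .one .l 3),
        (9, .one .l 4), (19, .one .l 5)]),
      (.two (.e true) 1 4, 2, [(69, .c), (1, .two .b 1 2), (1, .two .b 1 3), (14, .two .b 2 3)]),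
      (.two (.d false) 1 4, 1, [(23, .one .l 0), (3, .one .l 3), (3, .two (.d false) 1 2)]),
      (.two (.e false) 1 4, 2, [(69, .c), (1, .two .b 1 2), (1, .two .b 1 3), (14, .two .b 2 3)])]),
    (.two (.y true) 2 4, [
      (.two (.d true) 1 3, 1, [(7, .one .l 0), (8, .one .l 1), (3, .one .l 2), (9, .one .l 3),
        (10, .one .l 4), (16, .one .l 5)]),
      (.two (.d false) 1 3, 1, [(31, .one .l 0), (3, .one .l 4), (3, .two (.d false) 1 2)])]),
    (.two (.y true) 3 4, [
      (.two (.d true) 1 2, 1, [(21, .one .l 0), (9, .one .l 2), (3, .one .l 3), (3, .one .l 4),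
        (3, .one .l 5)]),
      (.two (.d false) 1 2, 1, [(68, .one .l 0), (1, .one .l 3), (1, .one .l 4),
        (1, .two (.d false) 1 2)])]),
    (.two (.a true) 1 2, [
      (.two (.d true) 3 4, 1, [(5, .one .l 0), (42, .one .l 1), (14, .one .l 2), (28, .one .l 3),
        (49, .one .l 4), (63, .one .l 5)]),
      (.two (.d false) 3 4, 1, [(51, .one .l 0), (18, .one .l 1), (6, .one .l 2), (21, .one .l 3),
        (14, .one .l 4), (25, .one .l 5)])]),
    (.two (.a true) 1 3, [
      (.two (.d true) 2 4, 1, [(5, .one .l 0), (38, .one .l 1), (28, .one .l 2), (14, .one .l 3),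
        (45, .one .l 4), (63, .one .l 5)]),
      (.two (.d false) 2 4, 1, [(68, .one .l 0), (15, .one .l 1), (21, .one .l 2), (6, .one .l 3),
        (12, .one .l 4), (24, .one .l 5)])]),
    (.two (.a true) 1 4, [
      (.two (.d true) 2 3, 1, [(6, .one .l 0), (31, .one .l 1), (24, .one .l 2), (45, .one .l 3),
        (14, .one .l 4), (60, .one .l 5)]),
      (.two (.d false) 2 3, 1, [(83, .one .l 0), (13, .one .l 1), (19, .one .l 2),
        (12, .one .l 3), (6, .one .l 4), (24, .one .l 5)])]),
    (.two (.a true) 2 3, [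
      (.two (.d true) 1 4, 1, [(9, .one .l 0), (28, .one .l 1), (38, .one .l 2), (10, .one .l 3),
        (29, .one .l 4), (51, .one .l 5)]),
      (.two (.d false) 1 4, 1, [(121, .one .l 0), (21, .one .l 1), (15, .one .l 2),
        (3, .one .l 3), (4, .one .l 4), (11, .one .l 5)])]),
    (.two (.a true) 2 4, [
      (.two (.d true) 1 3, 1, [(10, .one .l 0), (24, .one .l 1), (31, .one .l 2), (29, .one .l 3),
        (10, .one .l 4), (48, .one .l 5)]),
      (.two (.d false) 1 3, 1, [(133, .one .l 0), (19, .one .l 1), (13, .one .l 2),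
        (4, .one .l 3), (3, .one .l 4), (11, .one .l 5)])]),
    (.two (.a true) 3 4, [
      (.two (.d true) 1 2, 1, [(29, .one .l 2), (23, .one .l 3), (1, .one .l 4), (8, .one .k 1),
        (1, .one .k 2)]),
      (.two (.d false) 1 2, 1, [(167, .one .l 0), (11, .one .l 1), (4, .one .l 2),
        (13, .one .l 3), (1, .one .l 4), (5, .one .l 5)])]),
    (.two (.d true) 1 2, [
      (.two (.e true) 3 4, 1, [(21, .one .s 2), (6, .one .s 4), (9, .two (.d false) 2 3)]),
      (.two (.e false) 3 4, 1, [(5, .one .l 1), (73, .one .l 2), (3, .one .l 3), (70, .one .l 4),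
        (24, .one .k 1)])]),
    (.two (.d true) 1 3, [
      (.two (.e true) 2 4, 1, [(67, .one .l 0), (56, .one .l 1), (3, .one .l 2), (45, .one .l 3),
        (70, .one .l 4), (112, .one .l 5)]),
      (.two (.e false) 2 4, 1, [(34, .one .l 1), (3, .one .l 2), (73, .one .l 3),
        (143, .one .l 4), (23, .one .k 1)])]),
    (.two (.d true) 2 3, [
      (.two (.e true) 1 4, 1, [(95, .one .l 0), (3, .one .l 1), (56, .one .l 2), (101, .one .l 3),
        (98, .one .l 4), (140, .one .l 5)]),
      (.two (.e false) 1 4, 1, [(28, .one .l 2), (98, .one .l 3), (146, .one .l 4),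
        (3, .one .k 1), (29, .one .k 2)])]),
    (.two (.d true) 1 4, [
      (.two (.e true) 2 3, 1, [(14, .one .l 0), (60, .one .l 1), (10, .one .l 2), (70, .one .l 3),
        (45, .one .l 4), (115, .one .l 5)]),
      (.two (.e false) 2 3, 1, [(7, .one .l 3), (55, .one .l 4), (15, .two (.d true) 1 3),
        (2, .two (.d true) 2 3), (5, .two (.d true) 3 3)])]),
    (.two (.d true) 2 4, [
      (.two (.e true) 1 3, 1, [(60, .one .l 0), (10, .one .l 1), (60, .one .l 2), (98, .one .l 3),
        (101, .one .l 4), (143, .one .l 5)]),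
      (.two (.e false) 1 3, 1, [(7, .one .l 1), (4, .one .s 1), (13, .two (.d true) 3 3),
        (15, .two (.d true) 2 4), (2, .two (.d true) 3 4)])]),
    (.two (.d true) 3 4, [
      (.two (.e true) 1 2, 1, [(98, .one .l 2), (56, .one .l 3), (98, .one .l 4),
        (112, .one .l 5), (14, .one .k 1)]),
      (.two (.e false) 1 2, 1, [(7, .one .l 0), (14, .one .l 1), (196, .one .l 2),
        (60, .one .l 3), (105, .one .l 4), (45, .one .l 5)])])]

/-- The entry of a list for the key `V`. -/
def findEntry {α : Type} (V : Gen) (l : List (Gen × α)) : Option α :=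
  (l.find? fun r => Nat.beq V.code r.1.code).map fun r => r.2

/-- The entry of `certTable` for the pair `[V, W]`. -/
def findCert (V W : Gen) : Option (ℕ × List (ℕ × Gen)) :=
  (findEntry V certTable).bind (findEntry W)

/-- The certificate for `[V, W]`, found in `certTable` up to symmetries if it is listed there. -/
def cert (K : ℕ) (V W : Gen) : ℕ × List (ℕ × Gen) :=
  match (findCert V W).or (findCert W V) with
  | some r => r
  | none =>
    match (findCert (V.comp K) (W.comp K)).or (findCert (W.comp K) (V.comp K)) with
    | some r => (r.1, r.2.map fun p => (p.1, p.2.comp K))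
    | none => (3, [(growth ((V.size + W.size - 2) / 2), .c)])

/-- The members of a family with prescribed types of the ends, as weighted pairs of strengths. -/
def typed (b b' : Bool) (X : Family) : List (ℕ × ℕ × ℕ) :=
  (X.filter fun x => x.2.1.1 == b && x.2.2.1 == b').map fun x => (x.1, x.2.1.2, x.2.2.2)

/-- The total weight of the members of second strength at least `p'`. -/
def above (p' : ℕ) (X : List (ℕ × ℕ × ℕ)) : ℕ :=
  X.foldr (fun x s => bif Nat.ble p' x.2.2 then x.1 + s else s) 0

/-- Test of the domination of `N • X` by `Y` on the indicators of types `b`, `b'`. -/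
def domTyped (K N : ℕ) (X Y : List (ℕ × ℕ × ℕ)) : Bool :=
  (List.range (K + 1)).all fun p => (List.range (K + 1)).all fun p' =>
    Nat.ble (N * above p' (X.filter fun x => Nat.ble p x.2.1))
      (above p' (Y.filter fun x => Nat.ble p x.2.1))

/-- The weighted union of the families of generators. -/
def combine (K : ℕ) (cs : List (ℕ × Gen)) : Family :=
  cs.flatMap fun p => (p.2.family K).map fun x => (p.1 * x.1, x.2)

/-- Test of the domination of `N • X` by `Y` for symmetric families. -/
def dom (K N : ℕ) (X Y : Family) : Bool :=
  domTyped K N (typed true true X) (typed true true Y) &&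
  domTyped K N (typed false false X) (typed false false Y) &&
  domTyped K N (typed true false X) (typed true false Y)

/-- A common multiple of the relevant values of `growth`. -/
def den : ℕ := 7 * 6 ^ 6

/-- The number of pairs of leaves that are dropped in passing to a generator. -/
def rest (n : ℕ) (p : ℕ × Gen) : ℕ := (n - p.2.size) / 2

/-- Test of the certificate for `[V, W]`. -/
def check (K : ℕ) (V W : Gen) : Bool :=
  let n := V.size + W.size
  let r := cert K V W
  Nat.blt 0 r.1 &&
  r.2.all (fun p => decide (p.2.Valid K) && Nat.beq n (p.2.size + 2 * rest n p) &&
    Nat.beq (growth (rest n p) * (3 * den / growth (rest n p))) (3 * den)) &&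
  Nat.ble (r.2.map fun p => p.1 * (3 * den / growth (rest n p))).sum (r.1 * den) &&
  dom K r.1 (prod K (V.family K) (W.family K)) (combine K r.2)

/-- All one-parameter shapes. -/
def shapes₁ : List Shape₁ := [.l, .s, .k, .q]

/-- All two-parameter shapes. -/
def shapes₂ : List Shape₂ :=
  [.b, .y true, .y false, .a true, .a false, .d true, .d false, .e true, .e false]

set_option maxRecDepth 100000 in
lemma check_small : check 1 .c .c && shapes₁.all (fun σ => check 2 .c (.one σ 1) &&
      shapes₁.all fun σ' => check 3 (.one σ 1) (.one σ' 2)) &&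
    shapes₂.all (fun σ => check 3 .c (.two σ 1 2)) := by
  decide +kernel

set_option maxRecDepth 100000 in
lemma check_one_two : shapes₁.all fun σ => shapes₂.all fun σ' =>
    check 4 (.one σ 1) (.two σ' 2 3) && check 4 (.one σ 2) (.two σ' 1 3) &&
    check 4 (.one σ 3) (.two σ' 1 2) := by
  decide +kernel

set_option maxRecDepth 100000 in
lemma check_two_two : shapes₂.all fun σ => shapes₂.all fun σ' =>
    check 5 (.two σ 1 2) (.two σ' 3 4) && check 5 (.two σ 1 3) (.two σ' 2 4) &&
    check 5 (.two σ 1 4) (.two σ' 2 3) := by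
  decide +kernel

lemma above_filter (p p' : ℕ) (X : List (ℕ × ℕ × ℕ)) :
    above p' (X.filter fun x => Nat.ble p x.2.1) =
      (X.map fun x => if p ≤ x.2.1 ∧ p' ≤ x.2.2 then x.1 else 0).sum := by
  induction X with
  | nil => rfl
  | cons x X ih =>
    rw [List.map_cons, List.sum_cons, ← ih]
    have hble : ∀ a b, Nat.ble a b = decide (a ≤ b) := fun a b => by
      rw [Bool.eq_iff_iff, Nat.ble_eq, decide_eq_true_iff]
    by_cases hp : p ≤ x.2.1 <;> by_cases hp' : p' ≤ x.2.2 <;> simp [hble, above, hp, hp']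

lemma val_ind (b p b' p' X) : val (ind b p b' p') X =
    above p' ((typed b b' X).filter fun x => Nat.ble p x.2.1) := by
  rw [above_filter]
  induction X with
  | nil => rfl
  | cons x X ih =>
    rw [val_cons, ih, typed, typed, List.filter_cons]
    by_cases hb : x.2.1.1 = b <;> by_cases hb' : x.2.2.1 = b' <;> simp [ind, hb, hb']

lemma val_ind_eq_zero {K X b p b' p'} (hX : Bdd K X) (h : K < p ∨ K < p') :
    val (ind b p b' p') X = 0 := by
  have := val_mono_of_bdd (g := 0) (f := ind b p b' p') hX fun s e hs he => by
    rw [ind, if_neg]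
    · exact le_rfl
    · omega
  rw [val_zero] at this
  omega

lemma domTyped_spec {K N b b' X Y} (hX : Bdd K X)
    (h : domTyped K N (typed b b' X) (typed b b' Y)) (p p' : ℕ) :
    N * val (ind b p b' p') X ≤ val (ind b p b' p') Y := by
  by_cases hp : K < p ∨ K < p'
  · simp [val_ind_eq_zero hX hp]
  · push Not at hp
    simp only [domTyped, List.all_eq_true, List.mem_range, Nat.ble_eq] at h
    rw [val_ind, val_ind]
    exact h p (by omega) p' (by omega)

lemma dom_spec {K N X Y} (hX : Bdd K X) (sX : Symm X) (sY : Symm Y) (h : dom K N X Y)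
    (b p b' p') : N * val (ind b p b' p') X ≤ val (ind b p b' p') Y := by
  simp only [dom, Bool.and_eq_true] at h
  obtain ⟨⟨h1, h2⟩, h3⟩ := h
  rcases b <;> rcases b'
  · exact domTyped_spec hX h2 p p'
  · have hc : (fun s e => ind false p true p' e s) = ind true p' false p := by
      funext s e
      simp only [ind, and_comm]
    rw [sX, sY, hc]
    exact domTyped_spec hX h3 p' p
  · exact domTyped_spec hX h3 p p'
  · exact domTyped_spec hX h1 p p'

lemma val_combine (f K cs) :
    val f (combine K cs) = (cs.map fun p => p.1 * val f (p.2.family K)).sum := by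
  induction cs with
  | nil => rfl
  | cons p cs ih =>
    have h : combine K (p :: cs) =
        ((p.2.family K).map fun x => (p.1 * x.1, x.2)) ++ combine K cs := rfl
    rw [h, val_append, ih, List.map_cons, List.sum_cons]
    simp [val, Function.comp_def, mul_assoc, List.sum_map_mul_left]

lemma symm_combine (K cs) : Symm (combine K cs) := by
  intro f
  rw [val_combine, val_combine]
  congr 2
  funext p
  rw [Gen.symm_family K p.2 f]

lemma bdd_combine {K cs} (h : ∀ p ∈ cs, Gen.Valid K p.2) : Bdd K (combine K cs) := by
  intro x hx
  simp only [combine, List.mem_flatMap, List.mem_map] at hx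
  obtain ⟨p, hp, y, hy, rfl⟩ := hx
  exact (h p hp).bdd y hy

/-- The bound `B` holds for all generators obtained by dropping pairs from `n` leaves. -/
def Bounds (M n : ℕ) (f : End → End → ℕ) (B : ℕ) : Prop :=
  ∀ V : Gen, V.Valid M → ∀ k, n = V.size + 2 * k → growth k * val f (V.family M) ≤ B

/-- The product of `V` and `W` obeys all bounds valid for generators. -/
def Good (M : ℕ) (V W : Gen) : Prop :=
  ∀ f ∈ Tests, ∀ B m, Bounds M (V.size + W.size + 2 * m) f B →
    growth m * val f (prod M (V.family M) (W.family M)) ≤ B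

lemma Good.symm {M V W} (h : Good M V W) : Good M W V := by
  intro f hf B m hB
  rw [val_prod_comm]
  exact h f hf B m (by rwa [add_comm V.size])

lemma Gen.size_map (τ) (V : Gen) : (V.map τ).size = V.size := by
  rcases V with _ | ⟨_ | _ | _ | _, _⟩ | ⟨_ | _ | _ | _ | _, _, _⟩ <;> rfl

lemma good_map {K M : ℕ} {τ : ℕ → ℕ} (hτ : Monotone τ) (h0 : τ 0 = 0) (hK : τ K = M) {V W : Gen}
    (hV : V.Valid K) (hW : W.Valid K) (h : check K V W) : Good M (V.map τ) (W.map τ) := by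
  intro f hf B m hB
  simp only [check, Bool.and_eq_true, List.all_eq_true, Nat.blt_eq, Nat.beq_eq, Nat.ble_eq,
    decide_eq_true_eq] at h
  obtain ⟨⟨⟨hN, hcs⟩, hsum⟩, hdom⟩ := h
  generalize cert K V W = r at hN hcs hsum hdom
  obtain ⟨N, cs⟩ := r
  dsimp only at hN hcs hsum hdom
  rw [Gen.size_map, Gen.size_map] at hB
  have hbdd := (hV.bdd.prod K hW.bdd)
  have h1 : N * val f (prod M ((V.map τ).family M) ((W.map τ).family M)) ≤
      (cs.map fun p => p.1 * val f ((p.2.map τ).family M)).sum := by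
    rw [family_map h0 hK hV, family_map h0 hK hW]
    refine (Nat.mul_le_mul_left N (val_prod_famMap_le hτ hK f hV.bdd hW.bdd)).trans ?_
    have := val_endMap_le (M := M) hτ hf hbdd (bdd_combine fun p hp => (hcs p hp).1.1)
      (dom_spec hbdd ((V.symm_family K).prod K (W.symm_family K)) (symm_combine K cs) hdom)
    rw [val_famMap]
    refine this.trans (le_of_eq ?_)
    rw [val_combine]
    congr 1
    refine List.map_congr_left fun p hp => ?_
    rw [family_map h0 hK (hcs p hp).1.1, val_famMap]
  have h2 : ∀ p ∈ cs, 3 * den * (growth m * (p.1 * val f ((p.2.map τ).family M))) ≤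
      3 * B * (p.1 * (3 * den / growth (rest (V.size + W.size) p))) := by
    intro p hp
    obtain ⟨⟨hv, hs⟩, hd⟩ := hcs p hp
    set k := rest (V.size + W.size) p
    have h3 := hB (p.2.map τ) (hv.map hτ hK) (k + m) (by rw [Gen.size_map]; omega)
    set e := 3 * den / growth k
    set v := val f ((p.2.map τ).family M)
    calc 3 * den * (growth m * (p.1 * v)) = growth k * growth m * v * (p.1 * e) := by
          rw [← hd]; ring
      _ ≤ 3 * growth (k + m) * v * (p.1 * e) :=
          Nat.mul_le_mul_right _ (Nat.mul_le_mul_right _ (growth_mul_le k m))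
      _ = 3 * (growth (k + m) * v) * (p.1 * e) := by ring
      _ ≤ 3 * B * (p.1 * e) := by gcongr
  have h4 := List.sum_le_sum h2
  rw [List.sum_map_mul_left, List.sum_map_mul_left, List.sum_map_mul_left] at h4
  have hden : 0 < 3 * den * N := by unfold den; positivity
  refine Nat.le_of_mul_le_mul_left ?_ hden
  set v := val f (prod M ((V.map τ).family M) ((W.map τ).family M))
  calc 3 * den * N * (growth m * v) = 3 * den * (growth m * (N * v)) := by ring
    _ ≤ 3 * den * (growth m * (cs.map fun p => p.1 * val f ((p.2.map τ).family M)).sum) := by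
        gcongr
    _ ≤ _ := h4
    _ ≤ 3 * B * (N * den) := by gcongr
    _ = 3 * den * N * B := by ring

lemma monotone_getD {l : List ℕ} {M : ℕ} (hl : l.Pairwise (· ≤ ·)) (hM : ∀ x ∈ l, x ≤ M) :
    Monotone fun i => l.getD i M := by
  refine monotone_nat_of_le_succ fun i => ?_
  simp only [List.getD_eq_getElem?_getD]
  by_cases h : i + 1 < l.length
  · have h' : i < l.length := by omega
    simp only [List.getElem?_eq_getElem h, List.getElem?_eq_getElem h', Option.getD_some]
    exact List.pairwise_iff_getElem.1 hl i (i + 1) h' h (Nat.lt_succ_self i)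
  · rw [List.getElem?_eq_none (not_lt.1 h)]
    by_cases h' : i < l.length
    · simp only [List.getElem?_eq_getElem h', Option.getD_some, Option.getD_none]
      exact hM _ (List.getElem_mem h')
    · simp [List.getElem?_eq_none (not_lt.1 h')]

lemma good_of_check (l : List ℕ) {M : ℕ} (hl : l.Pairwise (· ≤ ·)) (hM : ∀ x ∈ l, x ≤ M)
    {V W : Gen} (h : check (l.length + 1) V W) (hV : V.Valid (l.length + 1))
    (hW : W.Valid (l.length + 1)) :
    Good M (V.map fun i => (0 :: l).getD i M) (W.map fun i => (0 :: l).getD i M) :=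
  good_map (monotone_getD (by simpa using hl) (by simpa using hM)) rfl (by simp) hV hW h

lemma mem_shapes₁ (σ) : σ ∈ shapes₁ := by cases σ <;> simp [shapes₁]

lemma mem_shapes₂ (σ) : σ ∈ shapes₂ := by
  rcases σ with _ | ⟨_ | _⟩ | ⟨_ | _⟩ | ⟨_ | _⟩ | ⟨_ | _⟩ <;> simp [shapes₂]

lemma good_one_one {M σ σ' x y} (h : x ≤ y) (hy : y ≤ M) : Good M (.one σ x) (.one σ' y) := by
  have := check_small
  simp only [Bool.and_eq_true, List.all_eq_true] at this
  exact good_of_check [x, y] (by simpa using h) (by simp; omega)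
    ((this.1.2 σ (mem_shapes₁ σ)).2 σ' (mem_shapes₁ σ')) (by simp [Gen.Valid])
    (by simp [Gen.Valid])

lemma good_one_two {M σ σ' z x y} (hz : z ≤ M) (hxy : x ≤ y) (hy : y ≤ M) :
    Good M (.one σ z) (.two σ' x y) := by
  have := check_one_two
  simp only [Bool.and_eq_true, List.all_eq_true] at this
  obtain ⟨⟨h1, h2⟩, h3⟩ := this σ (mem_shapes₁ σ) σ' (mem_shapes₂ σ')
  rcases le_total z x with h | h
  · exact good_of_check [z, x, y] (by simp; omega) (by simp; omega) h1 (by simp [Gen.Valid])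
      (by simp [Gen.Valid])
  rcases le_total z y with h' | h'
  · exact good_of_check [x, z, y] (by simp; omega) (by simp; omega) h2 (by simp [Gen.Valid])
      (by simp [Gen.Valid])
  · exact good_of_check [x, y, z] (by simp; omega) (by simp; omega) h3 (by simp [Gen.Valid])
      (by simp [Gen.Valid])

lemma good_two_two {M σ σ' x y x' y'} (hx : x ≤ x') (hy : x ≤ y ∧ y ≤ M)
    (hy' : x' ≤ y' ∧ y' ≤ M) : Good M (.two σ x y) (.two σ' x' y') := by
  have := check_two_two
  simp only [Bool.and_eq_true, List.all_eq_true] at this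
  obtain ⟨⟨h1, h2⟩, h3⟩ := this σ (mem_shapes₂ σ) σ' (mem_shapes₂ σ')
  rcases le_total y x' with h | h
  · exact good_of_check [x, y, x', y'] (by simp; omega) (by simp; omega) h1 (by simp [Gen.Valid])
      (by simp [Gen.Valid])
  rcases le_total y y' with h' | h'
  · exact good_of_check [x, x', y, y'] (by simp; omega) (by simp; omega) h2 (by simp [Gen.Valid])
      (by simp [Gen.Valid])
  · exact good_of_check [x, x', y', y] (by simp; omega) (by simp; omega) h3 (by simp [Gen.Valid])
      (by simp [Gen.Valid])

lemma good (M : ℕ) : ∀ V W : Gen, V.Valid M → W.Valid M → Good M V W := by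
  have hs := check_small
  simp only [Bool.and_eq_true, List.all_eq_true] at hs
  have h1 : ∀ σ x, x ≤ M → Good M .c (.one σ x) := fun σ x hx =>
    good_of_check [x] (by simp) (by simpa using hx) (hs.1.2 σ (mem_shapes₁ σ)).1 trivial
      (by simp [Gen.Valid])
  have h2 : ∀ σ x y, x ≤ y ∧ y ≤ M → Good M .c (.two σ x y) := fun σ x y h =>
    good_of_check [x, y] (by simpa using h.1) (by simp; omega) (hs.2 σ (mem_shapes₂ σ)) trivial
      (by simp [Gen.Valid])
  rintro (_ | ⟨σ, x⟩ | ⟨σ, x, y⟩) (_ | ⟨σ', x'⟩ | ⟨σ', x', y'⟩) hV hW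
  · exact good_of_check [] (by simp) (by simp) hs.1.1 trivial trivial
  · exact h1 _ _ hW
  · exact h2 _ _ _ hW
  · exact (h1 _ _ hV).symm
  · rcases le_total x x' with h | h
    · exact good_one_one h hW
    · exact (good_one_one h hV).symm
  · exact good_one_two hV hW.1 hW.2
  · exact (h2 _ _ _ hV).symm
  · exact (good_one_two hW hV.1 hV.2).symm
  · rcases le_total x x' with h | h
    · exact good_two_two h hV hW
    · exact (good_two_two h hW hV).symm

/-- The family of typed alternating words in the expansion of a tree. -/
def obj (M : ℕ) : BTree → Family
  | .leaf x => (Gen.one .l x).family M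
  | .node t u => prod M (obj M t) (obj M u)

lemma symm_obj (M t) : Symm (obj M t) := by
  induction t with
  | leaf x => exact Gen.symm_family M _
  | node t u ht hu => exact ht.prod M hu

/-- Bounds for generators extend to all trees. -/
lemma three_mul_val_obj_le {M : ℕ} (t : BTree) (ht : ∀ x ∈ t.leaves, x ≤ M) {f} (hf : f ∈ Tests)
    {B} (hB : Bounds M t.leaves.length f B) : 3 * val f (obj M t) ≤ B := by
  induction t generalizing f B with
  | leaf x =>
    exact hB (.one .l x) (ht x (by simp [BTree.leaves])) 0 (by simp [BTree.leaves, Gen.size])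
  | node t u iht ihu =>
    simp only [BTree.leaves, List.mem_append, List.length_append] at ht hB
    rw [obj, val_prod]
    refine iht (fun x hx => ht x (.inl hx)) (star_mem_tests _ _ hf) fun V hV j hj => ?_
    rw [← val_prod, val_prod_comm, val_prod, ← val_smul]
    refine Nat.le_of_mul_le_mul_left ?_ (show 0 < 3 by norm_num)
    refine ihu (fun x hx => ht x (.inr hx)) (nsmul_mem (star_mem_tests _ _ hf) _)
      fun W hW k hk => ?_
    rw [val_smul, ← val_prod, ← mul_assoc]
    refine (Nat.mul_le_mul_right _ (growth_mul_le k j)).trans ?_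
    rw [mul_assoc]
    refine Nat.mul_le_mul_left _ (good M W V hW hV f hf B (k + j) ?_)
    rwa [show W.size + V.size + 2 * (k + j) = t.leaves.length + u.leaves.length by omega]

/-- The indicator of words beginning with a peak. -/
def fromPeak : End → End → ℕ := ind true 0 true 0 + ind true 0 false 0

/-- The indicator of words leading from a peak to a valley. -/
def peakValley : End → End → ℕ := ind true 0 false 0

lemma fromPeak_apply (s e) : fromPeak s e = if s.1 then 1 else 0 := by
  obtain ⟨_ | _, _⟩ := s <;> obtain ⟨_ | _, _⟩ := e <;> simp [fromPeak, ind]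

lemma fromPeak_mem_tests : fromPeak ∈ Tests :=
  add_mem (ind_mem_tests _ _ _ _) (ind_mem_tests _ _ _ _)

lemma val_fromPeak_family (M) (V : Gen) :
    (V.size % 2 = 0 → 6 * val fromPeak (V.family M) ≤ growth (V.size / 2)) ∧
    (V.size % 2 = 1 → 3 * val fromPeak (V.family M) ≤ growth (V.size / 2)) := by
  rcases V with _ | ⟨_ | _ | _ | _, _⟩ | ⟨_ | ⟨_ | _⟩ | ⟨_ | _⟩ | ⟨_ | _⟩ | ⟨_ | _⟩, _, _⟩ <;>
    simp [Gen.size, Gen.family, mir, Gen.desc, Gen.twoFamily, fromPeak_apply, endAt, growth]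

lemma val_fromPeak_obj_le {M : ℕ} (t : BTree) (ht : ∀ x ∈ t.leaves, x ≤ M) :
    (t.leaves.length % 2 = 0 →
      6 * val fromPeak (obj M t) ≤ growth (t.leaves.length / 2)) ∧
    (t.leaves.length % 2 = 1 →
      3 * val fromPeak (obj M t) ≤ growth (t.leaves.length / 2)) := by
  constructor
  · intro h
    have := three_mul_val_obj_le t ht (nsmul_mem fromPeak_mem_tests 2)
      (B := growth (t.leaves.length / 2)) fun V hV k hk => ?_
    · rw [val_smul] at this
      omega
    have h1 := (val_fromPeak_family M V).1 (by omega)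
    have h2 := growth_mul_le k (V.size / 2)
    rw [show k + V.size / 2 = t.leaves.length / 2 by omega] at h2
    rw [val_smul]
    have h3 := Nat.mul_le_mul_left (growth k) h1
    rw [mul_left_comm] at h3 ⊢
    omega
  · intro h
    refine three_mul_val_obj_le t ht fromPeak_mem_tests fun V hV k hk => ?_
    have h1 := (val_fromPeak_family M V).2 (by omega)
    have h2 := growth_mul_le k (V.size / 2)
    rw [show k + V.size / 2 = t.leaves.length / 2 by omega] at h2
    have h3 := Nat.mul_le_mul_left (growth k) h1
    rw [mul_left_comm] at h3
    omega

/-- The last end of a word starting with an end of type `b`, provided that the word alternates. -/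
def lastEnd (M : ℕ) : Bool → List ℕ → Option End
  | _, [] => none
  | b, [x] => some (endAt M b x)
  | b, x :: y :: w =>
    if joins M (endAt M b x) (endAt M (!b) y) then lastEnd M (!b) (y :: w) else none

/-- The value of `f` on a word starting with an end of type `b`. -/
def score (M : ℕ) (f : End → End → ℕ) (b : Bool) (w : List ℕ) : ℕ :=
  (lastEnd M b w).elim 0 (f (endAt M b (w.headD 0)))

lemma lastEnd_append (M) {u v : List ℕ} (hu : u ≠ []) (hv : v ≠ []) (b) :
    lastEnd M b (u ++ v) = (lastEnd M b u).bind fun e =>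
      if joins M e (endAt M (!e.1) (v.headD 0)) then lastEnd M (!e.1) v else none := by
  induction u generalizing b with
  | nil => exact absurd rfl hu
  | cons x u ih =>
    cases u with
    | nil =>
      obtain ⟨y, v, rfl⟩ := List.exists_cons_of_ne_nil hv
      simp [lastEnd, endAt]
    | cons y u =>
      rw [List.cons_append, List.cons_append, lastEnd, lastEnd]
      split_ifs
      · exact ih (by simp) _
      · rfl

lemma score_append (M f) {u v : List ℕ} (hu : u ≠ []) (hv : v ≠ []) (b) :
    score M f b (u ++ v) = score M (fun s e => ∑ c, score M
      (fun s' e' => if joins M e s' then f s e' else 0) c v) b u := by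
  obtain ⟨x, u, rfl⟩ := List.exists_cons_of_ne_nil hu
  simp only [score, lastEnd_append M hu hv]
  cases lastEnd M b (x :: u) with
  | none => rfl
  | some e =>
    obtain ⟨c, e⟩ := e
    have hc : joins M (c, e) (endAt M c (v.headD 0)) = false := by simp [joins, endAt]
    have hz : ∀ o : Option End, o.elim 0 (fun _ => (0 : ℕ)) = 0 := by rintro (_ | _) <;> rfl
    simp only [Option.bind_some, Option.elim_some]
    by_cases h : joins M (c, e) (endAt M (!c) (v.headD 0))
    · cases c <;> simp_all
    · cases c <;> simp_all

lemma perm_of_mem_words {t : BTree} {w} (h : w ∈ t.words) : w.Perm t.leaves := by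
  induction t generalizing w with
  | leaf x =>
    simp only [BTree.words, Finset.mem_singleton] at h
    rw [h, BTree.leaves]
  | node t u iht ihu =>
    simp only [BTree.words, Finset.mem_union, Finset.mem_image, Finset.mem_product,
      Prod.exists] at h
    rcases h with ⟨a, b, ⟨ha, hb⟩, rfl⟩ | ⟨a, b, ⟨ha, hb⟩, rfl⟩
    · exact (iht ha).append (ihu hb)
    · exact List.perm_append_comm.trans ((iht ha).append (ihu hb))

lemma leaves_ne_nil (t : BTree) : t.leaves ≠ [] := by
  induction t with
  | leaf x => simp [BTree.leaves]
  | node t u iht _ => simp [BTree.leaves, iht]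

lemma ne_nil_of_mem_words {t : BTree} {w} (h : w ∈ t.words) : w ≠ [] := by
  rintro rfl
  exact leaves_ne_nil t (perm_of_mem_words h).symm.eq_nil

lemma sum_words_node {t u : BTree} (h : (BTree.node t u).leaves.Nodup) (g : List ℕ → ℕ) :
    ∑ w ∈ (BTree.node t u).words, g w =
      ∑ a ∈ t.words, ∑ b ∈ u.words, g (a ++ b) + ∑ b ∈ u.words, ∑ a ∈ t.words, g (b ++ a) := by
  have hl : ∀ {t : BTree} {a b}, a ∈ t.words → b ∈ t.words → a.length = b.length :=
    fun ha hb => (perm_of_mem_words ha).length_eq.trans (perm_of_mem_words hb).length_eq.symm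
  rw [BTree.words, Finset.sum_union, Finset.sum_image, Finset.sum_image, Finset.sum_product,
    Finset.sum_product, Finset.sum_comm (s := t.words) (f := fun a b => g (b ++ a))]
  · rintro ⟨a, b⟩ hab ⟨a', b'⟩ hab' h
    simp only [Finset.coe_product, Set.mem_prod, Finset.mem_coe] at hab hab'
    obtain ⟨h1, h2⟩ := List.append_inj h (hl hab.2 hab'.2)
    simp_all
  · rintro ⟨a, b⟩ hab ⟨a', b'⟩ hab' h
    simp only [Finset.coe_product, Set.mem_prod, Finset.mem_coe] at hab hab'
    obtain ⟨h1, h2⟩ := List.append_inj h (hl hab.1 hab'.1)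
    simp_all
  · rw [Finset.disjoint_left]
    intro w hw hw'
    simp only [Finset.mem_image, Finset.mem_product, Prod.exists] at hw hw'
    obtain ⟨a, b, ⟨ha, -⟩, rfl⟩ := hw
    obtain ⟨a', b', ⟨-, hb'⟩, he⟩ := hw'
    obtain ⟨x, a, rfl⟩ := List.exists_cons_of_ne_nil (ne_nil_of_mem_words ha)
    obtain ⟨y, b', rfl⟩ := List.exists_cons_of_ne_nil (ne_nil_of_mem_words hb')
    simp only [List.cons_append, List.cons.injEq] at he
    obtain ⟨rfl, -⟩ := he
    rw [BTree.leaves, List.nodup_append'] at h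
    exact h.2.2 ((perm_of_mem_words ha).subset List.mem_cons_self)
      ((perm_of_mem_words hb').subset List.mem_cons_self)

lemma val_obj {M : ℕ} {t : BTree} (h : t.leaves.Nodup) (f) :
    val f (obj M t) = ∑ b, ∑ w ∈ t.words, score M f b w := by
  induction t generalizing f with
  | leaf x => simp [obj, Gen.family, BTree.words, score, lastEnd]
  | node t u iht ihu =>
    have h' := h
    rw [BTree.leaves, List.nodup_append'] at h'
    have key : ∀ {t u : BTree}, (∀ f, val f (obj M t) = ∑ b, ∑ w ∈ t.words, score M f b w) →
        (∀ f, val f (obj M u) = ∑ b, ∑ w ∈ u.words, score M f b w) →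
        val f (cat M (obj M t) (obj M u)) =
          ∑ b, ∑ a ∈ t.words, ∑ a' ∈ u.words, score M f b (a ++ a') := by
      intro t u ht hu
      rw [val_cat, ht]
      refine Finset.sum_congr rfl fun b _ => Finset.sum_congr rfl fun a ha => ?_
      rw [Finset.sum_congr rfl fun a' ha' => score_append M f (ne_nil_of_mem_words ha)
        (ne_nil_of_mem_words ha') b]
      simp only [hu]
      simp only [score]
      cases lastEnd M b a with
      | none => simp
      | some e => simp only [Option.elim_some]; rw [Finset.sum_comm]
    rw [obj, prod, val_append, key (iht h'.1) (ihu h'.2.1), key (ihu h'.2.1) (iht h'.1),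
      ← Finset.sum_add_distrib]
    exact Finset.sum_congr rfl fun b _ => (sum_words_node h _).symm

lemma isAlternating_cons_cons_cons (x y z : ℕ) (w) : IsAlternating (x :: y :: z :: w) ↔
    (x ≠ y ∧ ¬ (x < y ∧ y < z) ∧ ¬ (z < y ∧ y < x)) ∧ IsAlternating (y :: z :: w) := by
  constructor
  · rintro ⟨h1, h2⟩
    refine ⟨⟨h1 0 (by simp), h2 0 (by simp)⟩, fun i hi => h1 (i + 1) ?_, fun i hi => h2 (i + 1) ?_⟩
    · simpa using hi
    · simpa using hi
  · rintro ⟨⟨h1, h2⟩, h3, h4⟩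
    constructor
    · rintro (_ | i) hi
      · exact h1
      · exact h3 i (by simpa using hi)
    · rintro (_ | i) hi
      · exact h2
      · exact h4 i (by simpa using hi)

lemma joins_endAt {M x y : ℕ} (hx : x ≤ M) (hy : y ≤ M) (b) :
    joins M (endAt M b x) (endAt M (!b) y) ↔ bif b then y < x else x < y := by
  cases b <;> simp [joins, endAt, Nat.blt_eq] <;> omega

lemma isSome_lastEnd {M : ℕ} {w : List ℕ} (h0 : w ≠ []) (hM : ∀ x ∈ w, x ≤ M) (b) :
    (lastEnd M b w).isSome ↔ IsAlternating w ∧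
      (w.length ≤ 1 ∨ bif b then w.getD 1 0 < w.getD 0 0 else w.getD 0 0 < w.getD 1 0) := by
  induction w generalizing b with
  | nil => exact absurd rfl h0
  | cons x w ih =>
    cases w with
    | nil => simp [lastEnd, IsAlternating]
    | cons y w =>
      have hj := joins_endAt (hM x (by simp)) (hM y (by simp)) b
      have ih := ih (by simp) (fun x hx => hM x (by simp [hx])) (!b)
      cases w with
      | nil =>
        have : IsAlternating [x, y] ↔ x ≠ y := by
          constructor
          · intro h; exact h.1 0 (by simp)
          · refine fun h => ⟨fun i hi => ?_, fun i hi => ?_⟩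
            · obtain rfl : i = 0 := by simpa using hi
              exact h
            · simp at hi
        rw [this, lastEnd, lastEnd]
        split_ifs with h
        · rw [hj] at h
          cases b <;> simp at h ⊢ <;> omega
        · rw [hj] at h
          cases b <;> simp at h ⊢ <;> omega
      | cons z w =>
        rw [isAlternating_cons_cons_cons, lastEnd]
        split_ifs with h
        · rw [ih]
          rw [hj] at h
          by_cases hA : IsAlternating (y :: z :: w)
          · have hyz : y ≠ z := hA.1 0 (by simp)
            cases b <;> simp [hA] at h ⊢ <;> omega
          · simp [hA]
        · rw [hj] at h
          cases b <;> simp at h ⊢ <;> intros <;> omega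

lemma faltCount_eq {M : ℕ} {t : BTree} (h : t.leaves.Nodup) (hM : ∀ x ∈ t.leaves, x ≤ M) :
    faltCount t = val fromPeak (obj M t) := by
  rw [val_obj h, faltCount, Finset.card_filter, Fintype.sum_bool]
  have h1 : ∀ w ∈ t.words, score M fromPeak false w = 0 := by
    intro w _
    rw [score]
    cases lastEnd M false w <;> simp [fromPeak_apply, endAt]
  rw [Finset.sum_eq_zero h1, add_zero]
  refine Finset.sum_congr rfl fun w hw => ?_
  have := isSome_lastEnd (ne_nil_of_mem_words hw)
    (fun x hx => hM x ((perm_of_mem_words hw).mem_iff.1 hx)) true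
  rw [cond_true] at this
  rw [IsForwardAlternating, ← this, score]
  cases lastEnd M true w <;> simp [fromPeak_apply, endAt]

/-- Relabeling of the leaves. -/
def relabel (τ : ℕ → ℕ) : BTree → BTree
  | .leaf x => .leaf (τ x)
  | .node t u => .node (relabel τ t) (relabel τ u)

lemma leaves_relabel (τ t) : (relabel τ t).leaves = t.leaves.map τ := by
  induction t with
  | leaf x => rfl
  | node t u iht ihu => simp [relabel, BTree.leaves, iht, ihu]

lemma bdd_obj {K t} (ht : ∀ x ∈ t.leaves, x ≤ K) : Bdd K (obj K t) := by
  induction t with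
  | leaf x => exact Gen.Valid.bdd (g := .one .l x) (ht x (by simp [BTree.leaves]))
  | node t u iht ihu =>
    simp only [BTree.leaves, List.mem_append] at ht
    exact (iht fun x hx => ht x (.inl hx)).prod K (ihu fun x hx => ht x (.inr hx))

lemma joins_endMap_of_strictMono {K M : ℕ} {τ : ℕ → ℕ} (hτ : StrictMono τ) (hK : τ K ≤ M)
    {a b : End} (ha : a.2 ≤ K) (hb : b.2 ≤ K) :
    joins M (endMap K M τ a) (endMap K M τ b) = joins K a b := by
  obtain ⟨ta, a⟩ := a
  obtain ⟨tb, b⟩ := b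
  rw [Bool.eq_iff_iff]
  simp only [joins, endMap, Bool.and_eq_true, bne_iff_ne, Nat.blt_eq]
  refine and_congr_right fun h => ?_
  dsimp only at ha hb h
  cases ta <;> cases tb <;> simp only [ne_eq, not_true_eq_false] at h <;>
    simp only [cond_false, cond_true]
  · have h1 := hτ.lt_iff_lt (a := K - a) (b := b)
    have := hτ.monotone (show K - a ≤ K by omega)
    omega
  · have h1 := hτ.lt_iff_lt (a := K - b) (b := a)
    have := hτ.monotone (show K - b ≤ K by omega)
    omega

lemma obj_relabel {K M : ℕ} {τ : ℕ → ℕ} (hτ : StrictMono τ) (hK : τ K ≤ M) {t : BTree}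
    (ht : ∀ x ∈ t.leaves, x ≤ K) : obj M (relabel τ t) = famMap K M τ (obj K t) := by
  have key : ∀ {X Y}, Bdd K X → Bdd K Y → cat M (famMap K M τ X) (famMap K M τ Y) =
      famMap K M τ (cat K X Y) := by
    intro X Y hX hY
    simp only [cat, famMap, List.map_flatMap, List.flatMap_map, List.filter_map, List.map_map]
    refine List.flatMap_congr fun x hx => ?_
    congr 1
    refine List.filter_congr fun y hy => ?_
    exact joins_endMap_of_strictMono hτ hK (hX x hx).2 (hY y hy).1
  induction t with
  | leaf x =>
    have hx := ht x (by simp [BTree.leaves])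
    simp [relabel, obj, Gen.family, famMap, endMap_endAt, hx]
  | node t u iht ihu =>
    simp only [BTree.leaves, List.mem_append] at ht
    have h1 := fun x hx => ht x (.inl hx)
    have h2 := fun x hx => ht x (.inr hx)
    rw [relabel, obj, obj, iht h1, ihu h2, prod, key (bdd_obj h1) (bdd_obj h2),
      key (bdd_obj h2) (bdd_obj h1), prod]
    simp [famMap]

lemma ends_obj {M t z} (hz : z ∈ obj M t) :
    (∃ x ∈ t.leaves, z.2.1 = endAt M z.2.1.1 x) ∧ ∃ x ∈ t.leaves, z.2.2 = endAt M z.2.2.1 x := by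
  induction t generalizing z with
  | leaf x =>
    simp only [obj, Gen.family, List.mem_cons, List.not_mem_nil, or_false] at hz
    rcases hz with rfl | rfl <;> simp [BTree.leaves, endAt]
  | node t u iht ihu =>
    simp only [obj, prod, cat, List.mem_append, List.mem_flatMap, List.mem_map,
      List.mem_filter] at hz
    simp only [BTree.leaves, List.mem_append]
    rcases hz with ⟨x, hx, y, ⟨hy, -⟩, rfl⟩ | ⟨x, hx, y, ⟨hy, -⟩, rfl⟩
    · obtain ⟨⟨p, hp, h1⟩, -⟩ := iht hx
      obtain ⟨-, q, hq, h2⟩ := ihu hy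
      exact ⟨⟨p, .inl hp, h1⟩, q, .inr hq, h2⟩
    · obtain ⟨⟨p, hp, h1⟩, -⟩ := ihu hx
      obtain ⟨-, q, hq, h2⟩ := iht hy
      exact ⟨⟨p, .inr hp, h1⟩, q, .inl hq, h2⟩

lemma val_le_val_of_mem {f g : End → End → ℕ} {X : Family}
    (h : ∀ z ∈ X, f z.2.1 z.2.2 ≤ g z.2.1 z.2.2) : val f X ≤ val g X :=
  List.sum_le_sum fun z hz => Nat.mul_le_mul_left _ (h z hz)

/-- Lower bounds for functionals in terms of words leading from a peak to a valley. -/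
lemma add_mul_val_peakValley_le {M : ℕ} {t : BTree} {g : End → End → ℕ} {c d : ℕ}
    (hc : ∀ x ∈ t.leaves, ∀ y ∈ t.leaves, c ≤ g (endAt M true x) (endAt M false y))
    (hd : ∀ x ∈ t.leaves, ∀ y ∈ t.leaves, d ≤ g (endAt M false x) (endAt M true y)) :
    (c + d) * val peakValley (obj M t) ≤ val g (obj M t) := by
  have h1 : val (c • peakValley + d • fun s e => peakValley e s) (obj M t) =
      (c + d) * val peakValley (obj M t) := by
    rw [val_add, val_smul, val_smul, ← symm_obj M t peakValley, add_mul]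
  rw [← h1]
  refine val_le_val_of_mem fun z hz => ?_
  obtain ⟨⟨x, hx, h2⟩, y, hy, h3⟩ := ends_obj hz
  rw [h2, h3]
  have h4 : c ≤ g (true, x) (false, M - y) := hc x hx y hy
  have h5 : d ≤ g (false, M - x) (true, y) := hd x hx y hy
  rcases z.2.1.1 <;> rcases z.2.2.1 <;> simp [peakValley, ind, endAt, h4, h5]

lemma val_peakValley_relabel {K M : ℕ} {τ : ℕ → ℕ} (hτ : StrictMono τ) (hK : τ K ≤ M) {t : BTree}
    (ht : ∀ x ∈ t.leaves, x ≤ K) :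
    val peakValley (obj M (relabel τ t)) = val peakValley (obj K t) := by
  rw [obj_relabel hτ hK ht, val_famMap]
  congr 1
  funext s e
  simp [peakValley, ind, endMap]

/-- A tree on four more leaves with six times as many words. -/
def extend (n : ℕ) (t : BTree) : BTree :=
  .node (.node (.node (.leaf 0) (.node (relabel (· + 3) t) (.leaf (n + 3)))) (.leaf 2)) (.leaf 1)

lemma six_mul_le_extend {n : ℕ} {t : BTree} (ht : ∀ x ∈ t.leaves, x < n) :
    6 * val peakValley (obj (n - 1) t) ≤ val peakValley (obj (n + 3) (extend n t)) := by
  obtain ⟨m, rfl⟩ : ∃ m, n = m + 1 := by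
    obtain ⟨x, hx⟩ := List.exists_mem_of_ne_nil _ (leaves_ne_nil t)
    exact ⟨n - 1, by have := ht x hx; omega⟩
  rw [← val_peakValley_relabel (M := m + 1 + 3) (τ := (· + 3)) (fun a b h => by simpa using h)
    (by omega) fun x hx => by have := ht x hx; omega, extend]
  simp only [obj]
  rw [val_prod, val_prod, val_prod_comm, val_prod, val_prod]
  have hl : ∀ x ∈ (relabel (· + 3) t).leaves, 3 ≤ x ∧ x ≤ m + 3 := by
    intro x hx
    rw [leaves_relabel, List.mem_map] at hx
    obtain ⟨y, hy, rfl⟩ := hx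
    have := ht y hy
    omega
  refine add_mul_val_peakValley_le (c := 3) (d := 3) ?_ ?_
  · intro x hx y hy
    have h1 := hl x hx
    have h2 := hl y hy
    simp [star, Gen.family, endAt, joins, peakValley, ind, Nat.blt_eq]
    split_ifs <;> omega
  · intro x hx y hy
    have h1 := hl x hx
    have h2 := hl y hy
    simp [star, Gen.family, endAt, joins, peakValley, ind, Nat.blt_eq]
    split_ifs <;> omega

/-- There are trees with leaves `0, …, 2 * m - 1` attaining the bound. -/
lemma exists_peakValley (m : ℕ) (hm : 2 ≤ m) : ∃ t : BTree, t.leaves.Perm (List.range (2 * m)) ∧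
    growth m ≤ 6 * val peakValley (obj (2 * m - 1) t) := by
  induction m using Nat.strong_induction_on with
  | _ m ih =>
    obtain rfl | rfl | ⟨k, hk, rfl⟩ : m = 2 ∨ m = 3 ∨ ∃ k, 2 ≤ k ∧ m = k + 2 := by
      rcases lt_or_ge m 4 with h | h
      · omega
      · exact .inr (.inr ⟨m - 2, by omega, by omega⟩)
    · exact ⟨.node (.node (.node (.leaf 0) (.leaf 3)) (.leaf 2)) (.leaf 1), by decide,
        by decide +kernel⟩
    · exact ⟨.node (.node (.node (.leaf 0) (.leaf 5)) (.leaf 3))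
        (.node (.node (.leaf 1) (.leaf 4)) (.leaf 2)), by decide, by decide +kernel⟩
    · obtain ⟨t, ht, h⟩ := ih k (by omega) hk
      refine ⟨extend (2 * k) t, ?_, ?_⟩
      · have hp : (extend (2 * k) t).leaves.Perm
            (0 :: ((List.range (2 * k)).map (· + 3) ++ [2 * k + 3]) ++ [2] ++ [1]) := by
          simp only [extend, BTree.leaves, leaves_relabel, List.singleton_append]
          exact (((((ht.map _).append_right _).cons _).append_right _).append_right _)
        refine hp.trans ?_
        rw [List.perm_ext_iff_of_nodup ?_ List.nodup_range]
        · intro x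
          simp only [List.cons_append, List.mem_cons, List.mem_append, List.mem_map,
            List.mem_range, List.not_mem_nil, or_false]
          constructor
          · omega
          · intro hx
            rcases lt_or_ge x 3 with h3 | h3
            · omega
            rcases lt_or_ge x (2 * k + 3) with h4 | h4
            · exact .inr (.inl (.inl (.inl ⟨x - 3, by omega, by omega⟩)))
            · omega
        · simp [List.nodup_append, List.nodup_range.map (add_left_injective 3)]
          omega
      · rw [growth, show 2 * (k + 2) - 1 = 2 * k + 3 by omega]
        have := six_mul_le_extend fun x hx => List.mem_range.1 (ht.subset hx)
        omega

lemma leaves_perm_and_val_fromPeak_eq {n : ℕ} {t : BTree} (ht : t.leaves.Perm (List.range n)) :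
    (relabel (· + 1) t).leaves.Perm (List.range' 1 n) ∧
      val fromPeak (obj (n - 1) t) = faltCount (relabel (· + 1) t) := by
  have h : (relabel (· + 1) t).leaves.Perm (List.range' 1 n) := by
    rw [leaves_relabel, List.range'_eq_map_range]
    simpa [add_comm] using ht.map (· + 1)
  refine ⟨h, ?_⟩
  have hn : 0 < n := by
    rw [← List.length_range (n := n), ← ht.length_eq, List.length_pos_iff]
    exact leaves_ne_nil t
  rw [faltCount_eq (M := n) (h.nodup_iff.2 List.nodup_range'), obj_relabel (K := n - 1)
    (fun a b h => by simpa using h) (by omega), val_famMap]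
  · congr 1
    funext s e
    simp [fromPeak_apply, endMap]
  · intro x hx
    have := List.mem_range.1 (ht.subset hx)
    omega
  · intro x hx
    have := List.mem_range'_1.1 (h.subset hx)
    omega

lemma rFAlt_eq {n c B : ℕ} (hu : ∀ t : BTree, t.leaves.Perm (List.range' 1 n) →
    c * faltCount t ≤ B) (hc : 0 < c) {t : BTree} (ht : t.leaves.Perm (List.range n))
    (h : B ≤ c * val fromPeak (obj (n - 1) t)) : c * rFAlt n = B := by
  obtain ⟨h1, h2⟩ := leaves_perm_and_val_fromPeak_eq ht
  have hb : BddAbove {m | ∃ t : BTree, t.leaves.Perm (List.range' 1 n) ∧ m = faltCount t} := by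
    refine ⟨B, ?_⟩
    rintro _ ⟨t, ht, rfl⟩
    exact (Nat.le_mul_of_pos_left _ hc).trans (hu t ht)
  refine le_antisymm ?_ ?_
  · obtain ⟨t, ht, hm⟩ : rFAlt n ∈ {m | ∃ t : BTree, t.leaves.Perm (List.range' 1 n) ∧
        m = faltCount t} := Nat.sSup_mem ⟨_, _, h1, rfl⟩ hb
    rw [hm]
    exact hu t ht
  · refine h.trans (Nat.mul_le_mul_left c ?_)
    rw [h2]
    exact le_csSup hb ⟨_, h1, rfl⟩

lemma faltCount_le {n : ℕ} {t : BTree} (ht : t.leaves.Perm (List.range' 1 n)) :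
    (n % 2 = 0 → 6 * faltCount t ≤ growth (n / 2)) ∧
      (n % 2 = 1 → 3 * faltCount t ≤ growth (n / 2)) := by
  have hM : ∀ x ∈ t.leaves, x ≤ n := fun x hx => by
    have := List.mem_range'_1.1 (ht.subset hx)
    omega
  have hl : t.leaves.length = n := by rw [ht.length_eq, List.length_range']
  rw [faltCount_eq (ht.nodup_iff.2 List.nodup_range') hM, ← hl]
  rw [← hl] at hM
  exact val_fromPeak_obj_le t hM

lemma peakValley_le_fromPeak (s e) : peakValley s e ≤ fromPeak s e := by
  simp [peakValley, fromPeak]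

lemma six_mul_rFAlt (m : ℕ) (hm : 2 ≤ m) : 6 * rFAlt (2 * m) = growth m := by
  obtain ⟨t, ht, h⟩ := exists_peakValley m hm
  refine rFAlt_eq (fun u hu => ?_) (by norm_num) ht
    (h.trans (Nat.mul_le_mul_left 6 (val_mono peakValley_le_fromPeak _)))
  have := (faltCount_le hu).1 (by omega)
  rwa [show 2 * m / 2 = m by omega] at this

lemma three_mul_rFAlt (m : ℕ) (hm : 2 ≤ m) : 3 * rFAlt (2 * m + 1) = growth m := by
  obtain ⟨t, ht, h⟩ := exists_peakValley m hm
  have hlt : ∀ x ∈ t.leaves, x < 2 * m := fun x hx => List.mem_range.1 (ht.subset hx)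
  have hid : ∀ t, relabel id t = t := fun t => by
    induction t with
    | leaf x => rfl
    | node t u iht ihu => rw [relabel, iht, ihu]
  refine rFAlt_eq (t := .node t (.leaf (2 * m))) (fun u hu => ?_) (by norm_num) ?_ ?_
  · have := (faltCount_le hu).2 (by omega)
    rwa [show (2 * m + 1) / 2 = m by omega] at this
  · rw [List.range_succ]
    exact ht.append_right _
  · rw [← val_peakValley_relabel (M := 2 * m) strictMono_id (by simp)
      fun x hx => Nat.le_sub_one_of_lt (hlt x hx), hid] at h
    rw [Nat.add_sub_cancel, obj, val_prod]
    have := add_mul_val_peakValley_le (M := 2 * m) (t := t) (c := 1) (d := 1)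
      (g := star (2 * m) (obj (2 * m) (.leaf (2 * m))) fromPeak) ?_ ?_
    · omega
    all_goals
      intro x hx y hy
      simp [star, obj, Gen.family, endAt, joins, fromPeak_apply, Nat.blt_eq, hlt x hx, hlt y hy]

end AltWords

/-- For `n ≥ 4`, the scaling relation `r_{n+4}^forw = 6 r_n^forw`. -/
theorem rFAlt_scaling : ∀ n : ℕ, 4 ≤ n → rFAlt (n + 4) = 6 * rFAlt n := by
  intro n hn
  obtain ⟨m, rfl | rfl⟩ := Nat.even_or_odd' n
  · have h1 := AltWords.six_mul_rFAlt m (by omega)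
    have h2 := AltWords.six_mul_rFAlt (m + 2) (by omega)
    rw [AltWords.growth, ← h1, show 2 * (m + 2) = 2 * m + 4 by ring] at h2
    omega
  · have h1 := AltWords.three_mul_rFAlt m (by omega)
    have h2 := AltWords.three_mul_rFAlt (m + 2) (by omega)
    rw [AltWords.growth, ← h1, show 2 * (m + 2) + 1 = 2 * m + 1 + 4 by ring] at h2
    omega
end

section
/- The sequence (r_n)^{1/n} converges to 6^{1/4} as n → ∞; that is, the maximal number of alternating monomials in commutator monomials of order n grows with exponential rate exactly 6^{1/4} ≈ 1.56508. -/
open scoped Classical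

namespace AltGrowth

/-! ### Alternating words and their ends -/

/-- An end of an alternating word: the letter there, tagged `true` if it is a low letter (smaller
than its neighbour) and `false` if it is a high letter. -/
abbrev WordEnd (P : Type*) := Bool × P

/-- The two ends of an alternating word, in order. -/
abbrev Arc (P : Type*) := WordEnd P × WordEnd P

section Join

variable {P Q : Type*}

/-- Two ends can be glued if one is low, the other is high, and the low one is smaller. -/
def joins (lt : P → P → Bool) (e d : WordEnd P) : Bool :=
  bif e.1 then (bif d.1 then false else lt e.2 d.2)
  else (bif d.1 then lt d.2 e.2 else false)

/-- The ends of the alternating concatenations, in both orders, of two words with given ends. -/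
def glue (lt : P → P → Bool) (x y : Arc P) : List (Arc P) :=
  (bif joins lt x.2 y.1 then [(x.1, y.2)] else []) ++
    (bif joins lt y.2 x.1 then [(y.1, x.2)] else [])

/-- The ends of the alternating concatenations of words from two given families. -/
def glueAll (lt : P → P → Bool) (X Y : List (Arc P)) : List (Arc P) :=
  X.flatMap fun x => Y.flatMap fun y => glue lt x y

/-- The ends of a one-letter word, which counts both as low and as high. -/
def letter (z : P) : List (Arc P) := [((true, z), (true, z)), ((false, z), (false, z))]

/-- The ends of the words of a two-letter tree. -/
def pair (x y : P) : List (Arc P) := [((true, x), (false, y)), ((false, y), (true, x))]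

/-- Relabeling of the ends of a word. -/
def mapArc (p : P → Q) (x : Arc P) : Arc Q := ((x.1.1, p x.1.2), (x.2.1, p x.2.2))

/-- The sum of a weight over a family of words. -/
def total (φ : Arc P → ℝ) (X : List (Arc P)) : ℝ := (X.map φ).sum

lemma joins_comm (lt : P → P → Bool) (e d : WordEnd P) : joins lt e d = joins lt d e := by
  rcases e with ⟨_ | _, e⟩ <;> rcases d with ⟨_ | _, d⟩ <;> rfl

lemma total_append (φ : Arc P → ℝ) (X Y : List (Arc P)) :
    total φ (X ++ Y) = total φ X + total φ Y := by
  simp [total]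

lemma total_flatMap {α : Type*} (φ : Arc P → ℝ) (X : List α) (f : α → List (Arc P)) :
    total φ (X.flatMap f) = (X.map fun x => total φ (f x)).sum := by
  induction X with
  | nil => simp [total]
  | cons x X ih => rw [List.flatMap_cons, total_append, ih]; simp

lemma total_glue_comm (lt : P → P → Bool) (φ : Arc P → ℝ) (x y : Arc P) :
    total φ (glue lt x y) = total φ (glue lt y x) := by
  rw [glue, glue, total_append, total_append, add_comm]

lemma total_glueAll (lt : P → P → Bool) (φ : Arc P → ℝ) (X Y : List (Arc P)) :
    total φ (glueAll lt X Y) = (X.map fun x => (Y.map fun y => total φ (glue lt x y)).sum).sum := by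
  rw [glueAll, total_flatMap]
  simp_rw [total_flatMap]

lemma sum_map_sum_comm {α β : Type*} (X : List α) (Y : List β) (f : α → β → ℝ) :
    (X.map fun x => (Y.map fun y => f x y).sum).sum =
      (Y.map fun y => (X.map fun x => f x y).sum).sum := by
  induction X with
  | nil => simp
  | cons x X ih => simp [ih, List.sum_map_add]

lemma total_glueAll_comm (lt : P → P → Bool) (φ : Arc P → ℝ) (X Y : List (Arc P)) :
    total φ (glueAll lt X Y) = total φ (glueAll lt Y X) := by
  rw [total_glueAll, total_glueAll, sum_map_sum_comm]
  simp_rw [total_glue_comm lt φ]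

lemma total_add (φ ψ : Arc P → ℝ) (X : List (Arc P)) :
    total (fun x => φ x + ψ x) X = total φ X + total ψ X := by
  simp [total, List.sum_map_add]

lemma total_smul (φ : Arc P → ℝ) (c : ℝ) (X : List (Arc P)) :
    total (fun x => c * φ x) X = c * total φ X := by
  simp [total, List.sum_map_mul_left]

lemma total_glueAll_smul (lt : P → P → Bool) (φ : Arc P → ℝ) (c : ℝ) (X Y : List (Arc P)) :
    total (fun x => c * (Y.map fun y => total φ (glue lt x y)).sum) X =
      c * total φ (glueAll lt X Y) := by
  rw [total_glueAll, total, List.sum_map_mul_left]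

end Join

/-- The standard comparison of a linear order, as a Boolean function. -/
def blt {P : Type*} [LinearOrder P] (x y : P) : Bool := decide (x < y)

section Cone

variable {P : Type*} [LinearOrder P]

/-- The weight that counts the words whose ends can be glued to two given ends. -/
noncomputable def test (d d' : WordEnd P) (x : Arc P) : ℝ :=
  bif joins blt x.1 d && joins blt x.2 d' then 1 else 0

/-- The cone of weights generated by the test weights. -/
inductive Cone : (Arc P → ℝ) → Prop
  | zero : Cone fun _ => 0
  | test (d d' : WordEnd P) : Cone (test d d')
  | add {φ ψ : Arc P → ℝ} : Cone φ → Cone ψ → Cone fun x => φ x + ψ x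
  | smul {φ : Arc P → ℝ} (c : ℝ) : 0 ≤ c → Cone φ → Cone fun x => c * φ x

lemma test_nonneg (d d' : WordEnd P) (x : Arc P) : 0 ≤ test d d' x := by
  unfold test; cases joins blt x.1 d && joins blt x.2 d' <;> simp

lemma Cone.nonneg {φ : Arc P → ℝ} (h : Cone φ) (x : Arc P) : 0 ≤ φ x := by
  induction h with
  | zero => rfl
  | test d d' => exact test_nonneg d d' x
  | add _ _ h h' => exact add_nonneg h h'
  | smul c hc _ h => exact mul_nonneg hc h

lemma Cone.sum {α : Type*} (Y : List α) {F : α → Arc P → ℝ} (h : ∀ y, Cone (F y)) :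
    Cone fun x => (Y.map fun y => F y x).sum := by
  induction Y with
  | nil => exact Cone.zero
  | cons y Y ih => simpa using (h y).add ih

lemma Cone.glue {φ : Arc P → ℝ} (h : Cone φ) (y : Arc P) :
    Cone fun x => total φ (glue blt x y) := by
  induction h with
  | zero => simpa [total] using Cone.zero
  | test d d' =>
    have key : (fun x => total (AltGrowth.test d d') (AltGrowth.glue blt x y)) = fun x =>
        (bif joins blt y.2 d' then (1 : ℝ) else 0) * AltGrowth.test d y.1 x +
          (bif joins blt y.1 d then (1 : ℝ) else 0) * AltGrowth.test y.2 d' x := by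
      funext x
      rcases h₁ : joins blt x.2 y.1 <;> rcases h₂ : joins blt x.1 y.2 <;>
        rcases h₃ : joins blt y.2 d' <;> rcases h₄ : joins blt y.1 d <;>
        simp [AltGrowth.glue, total, AltGrowth.test, joins_comm blt y.2 x.1, h₁, h₂, h₃, h₄]
    rw [key]
    refine .add (.smul _ ?_ (.test _ _)) (.smul _ ?_ (.test _ _))
    · cases joins blt y.2 d' <;> simp
    · cases joins blt y.1 d <;> simp
  | @add φ ψ _ _ h h' =>
    have key : (fun x => total (fun x => φ x + ψ x) (AltGrowth.glue blt x y)) = fun x =>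
        total φ (AltGrowth.glue blt x y) + total ψ (AltGrowth.glue blt x y) := by
      funext x; simp [total, List.sum_map_add]
    rw [key]; exact h.add h'
  | @smul φ c hc _ h =>
    have key : (fun x => total (fun x => c * φ x) (AltGrowth.glue blt x y)) = fun x =>
        c * total φ (AltGrowth.glue blt x y) := by
      funext x; simp [total, List.sum_map_mul_left]
    rw [key]; exact h.smul c hc

end Cone

/-! ### Generators -/

section Generators

variable {P Q : Type*}

/-- The step function with values `l` followed by the constant `t`. -/
def place (l : List P) (t : P) (i : ℕ) : P := l.getD i t

/-- The words of the tree obtained from the leaf `1` by grafting `i` times the tree with the two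
leaves `0` and `2`. -/
def oddPattern : ℕ → List (Arc ℕ)
  | 0 => letter 1
  | i + 1 => glueAll Nat.blt (oddPattern i) (pair 0 2)

/-- The extremal family with an odd number of letters, with free letter `z` and bounds `b`, `t`. -/
def oddAt (b t : P) (i : ℕ) (z : P) : List (Arc P) :=
  (oddPattern i).map (mapArc (place [b, z] t))

/-- The shapes of the extremal families with an even number of letters: two odd families whose free
letters are `1` and `2`, or a single pair. -/
def evenPattern : ℕ → List (Arc ℕ)
  | 0 => glueAll Nat.blt (oddAt 0 3 0 1) (oddAt 0 3 1 2)
  | 1 => glueAll Nat.blt (oddAt 0 3 0 2) (oddAt 0 3 1 1)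
  | 2 => glueAll Nat.blt (oddAt 0 3 0 1) (oddAt 0 3 2 2)
  | 3 => glueAll Nat.blt (oddAt 0 3 0 2) (oddAt 0 3 2 1)
  | 4 => glueAll Nat.blt (oddAt 0 3 1 1) (oddAt 0 3 1 2)
  | _ => pair 0 3

/-- The level of an even family: half its number of letters. -/
def evenLevel (s : ℕ) : ℕ := [2, 2, 3, 3, 3, 1].getD s 1

/-- The extremal family with an even number of letters, with free letters `x`, `y` and bounds
`b`, `t`. -/
def evenAt (b t : P) (s : ℕ) (x y : P) : List (Arc P) :=
  (evenPattern s).map (mapArc (place [b, x, y] t))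

lemma map_place (p : P → Q) (l : List P) (t : P) (i : ℕ) :
    p (place l t i) = place (l.map p) (p t) i := by
  simp only [place, List.getD_eq_getElem?_getD, List.getElem?_map]
  cases l[i]? <;> rfl

lemma map_mapArc_place (p : P → Q) (l : List P) (t : P) (X : List (Arc ℕ)) :
    (X.map (mapArc (place l t))).map (mapArc p) = X.map (mapArc (place (l.map p) (p t))) := by
  rw [List.map_map]
  refine congrArg (fun f => X.map f) (funext fun x => ?_)
  simp only [Function.comp_apply, mapArc, map_place p]

lemma map_oddAt (p : P → Q) (b t : P) (i : ℕ) (z : P) :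
    (oddAt b t i z).map (mapArc p) = oddAt (p b) (p t) i (p z) :=
  map_mapArc_place p [b, z] t _

lemma map_evenAt (p : P → Q) (b t : P) (s : ℕ) (x y : P) :
    (evenAt b t s x y).map (mapArc p) = evenAt (p b) (p t) s (p x) (p y) :=
  map_mapArc_place p [b, x, y] t _

end Generators

section Domination

variable {P : Type*} [LinearOrder P] [BoundedOrder P]

/-- The extremal families of given parity (`true` for odd) and level. -/
inductive IsGen : Bool → ℕ → List (Arc P) → Prop
  | odd {i : ℕ} (hi : i < 3) (z : P) : IsGen true i (oddAt ⊥ ⊤ i z)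
  | even {s : ℕ} (hs : s < 6) {x y : P} (hxy : x ≤ y) :
      IsGen false (evenLevel s) (evenAt ⊥ ⊤ s x y)

/-- A weight is admissible if its normalized total on the extremal families is at most one. -/
def Admissible (o : Bool) (φ : Arc P → ℝ) : Prop :=
  Cone φ ∧ ∀ k X, IsGen o k X → total φ X ≤ √6 ^ k

/-- A family is dominated at level `k` if its normalized total against every admissible weight is
at most one. -/
def Dominated (o : Bool) (k : ℕ) (X : List (Arc P)) : Prop :=
  ∀ φ, Admissible o φ → total φ X ≤ √6 ^ k

lemma Dominated.glueAll_of_left {o o' : Bool} {k m : ℕ} {X Y : List (Arc P)}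
    (hX : Dominated o k X)
    (h : ∀ k' X', IsGen o k' X' → Dominated o' (k' + m) (glueAll blt X' Y)) :
    Dominated o' (k + m) (glueAll blt X Y) := by
  intro φ hφ
  have hs : 0 < √6 ^ m := by positivity
  have key : ∀ (k' : ℕ) (X' : List (Arc P)),
      total (fun x : Arc P => (√6 ^ m)⁻¹ * (Y.map fun y => total φ (glue blt x y)).sum) X' ≤ √6 ^ k' ↔
        total φ (glueAll blt X' Y) ≤ √6 ^ (k' + m) := by
    intro k' X'
    rw [total_glueAll_smul, inv_mul_le_iff₀ hs, pow_add, mul_comm]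
  refine (key k X).1 (hX _ ⟨.smul _ (by positivity) (.sum Y fun y => hφ.1.glue y), ?_⟩)
  intro k' X' hX'
  exact (key k' X').2 (h k' X' hX' φ hφ)

lemma Dominated.glueAll_comm {o : Bool} {k : ℕ} {X Y : List (Arc P)}
    (h : Dominated o k (glueAll blt X Y)) : Dominated o k (glueAll blt Y X) := by
  intro φ hφ
  rw [total_glueAll_comm]
  exact h φ hφ

lemma Dominated.bilinear {o o' o'' : Bool} {k m δ : ℕ} {X Y : List (Arc P)}
    (hX : Dominated o k X) (hY : Dominated o' m Y)
    (h : ∀ k' (X' : List (Arc P)) m' (Y' : List (Arc P)), IsGen o k' X' → IsGen o' m' Y' →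
      Dominated o'' (k' + m' + δ) (glueAll blt X' Y')) :
    Dominated o'' (k + m + δ) (glueAll blt X Y) := by
  rw [add_assoc]
  refine hX.glueAll_of_left fun k' X' hX' => ?_
  rw [show k' + (m + δ) = m + (k' + δ) by ring]
  refine (hY.glueAll_of_left fun m' Y' hY' => ?_).glueAll_comm
  rw [show m' + (k' + δ) = k' + m' + δ by ring]
  exact (h k' X' m' Y' hX' hY').glueAll_comm

end Domination

/-! ### Finite certificates for domination -/

section Certificates

/-- The number of words of a family whose ends can be glued to two given ends. -/
def hits (d d' : WordEnd ℕ) (X : List (Arc ℕ)) : ℕ :=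
  X.countP fun x => bif joins Nat.blt x.1 d then joins Nat.blt x.2 d' else false

/-- The ends with letters at most `T`. -/
def cells (T : ℕ) : List (WordEnd ℕ) :=
  (List.range (T + 1)).flatMap fun i => [(true, i), (false, i)]

/-- An upper bound for `3600000 * √6⁻¹ ^ j`. -/
def cost (j : ℕ) : ℕ := [3600000, 1469700, 600000, 244950, 100000, 40825].getD j 3600000

/-- The check that the family `D` of level `k` is dominated by the combination `c`, a list of
triples (coefficient, level, family), of total weight `N`. -/
def covers (N T k : ℕ) (D : List (Arc ℕ)) (c : List (ℕ × ℕ × List (Arc ℕ))) : Bool :=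
  (cells T).all (fun d => (cells T).all fun d' =>
      Nat.ble (N * hits d d' D) (c.map fun e => e.1 * hits d d' e.2.2).sum) &&
    (c.all (fun e => Nat.ble e.2.1 k) &&
      Nat.ble (c.map fun e => e.1 * cost (k - e.2.1)).sum (N * 3600000))

lemma le_cost_mul_pow (j : ℕ) : (3600000 : ℝ) ≤ cost j * √6 ^ j := by
  have hs : (3600000 / 1469700 : ℝ) ≤ √6 := Real.le_sqrt_of_sq_le (by norm_num)
  have hq : √6 ^ 2 = 6 := Real.sq_sqrt (by norm_num)
  have h₁ : (1 : ℝ) ≤ √6 := le_trans (by norm_num) hs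
  rcases lt_or_ge j 6 with h | h
  · have h₃ : √6 ^ 3 = 6 * √6 := by rw [pow_succ, hq]
    have h₄ : √6 ^ 4 = 36 := by rw [pow_succ, h₃, mul_assoc, ← sq, hq]; norm_num
    have h₅ : √6 ^ 5 = 36 * √6 := by rw [pow_succ, h₄]
    interval_cases j <;> simp [cost, hq, h₃, h₄, h₅] <;> linarith
  · have : cost j = 3600000 := by
      simp [cost, List.getElem?_eq_none (l := [3600000, 1469700, 600000, 244950, 100000, 40825]) h]
    rw [this]
    have := one_le_pow₀ h₁ (n := j)
    push_cast
    linarith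

lemma exists_threshold {q : ℕ → Prop} (hq : ∀ i j, i ≤ j → q i → q j) {T : ℕ} (hT : q T) :
    ∃ σ ≤ T, ∀ e, q e ↔ σ ≤ e :=
  ⟨Nat.find ⟨T, hT⟩, Nat.find_min' _ hT, fun _ =>
    ⟨Nat.find_min' _, fun h => hq _ _ h (Nat.find_spec ⟨T, hT⟩)⟩⟩

variable {P : Type*} [LinearOrder P]

lemma exists_index [BoundedOrder P] {p : ℕ → P} (hp : Monotone p) {T : ℕ} (h₀ : p 0 = ⊥)
    (hT : p T = ⊤) (d : WordEnd P) :
    (∀ e : WordEnd ℕ, joins blt (e.1, p e.2) d = false) ∨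
      ∃ d' ∈ cells T, ∀ e : WordEnd ℕ, joins blt (e.1, p e.2) d = joins Nat.blt e d' := by
  obtain ⟨_ | _, t⟩ := d
  · right
    obtain ⟨σ, hσ, h⟩ := exists_threshold (q := fun i => t ≤ p i) (T := T)
      (fun i j hij hi => hi.trans (hp hij)) (hT ▸ le_top)
    refine ⟨(false, σ), by simp [cells]; omega, ?_⟩
    rintro ⟨_ | _, e⟩
    · rfl
    · have := not_congr (h e)
      simp only [not_le] at this
      rw [Bool.eq_iff_iff]
      simpa [joins, blt, Nat.blt_eq] using this
  · by_cases hex : t < ⊤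
    · right
      obtain ⟨σ, hσ, h⟩ := exists_threshold (q := fun i => t < p i) (T := T)
        (fun i j hij hi => hi.trans_le (hp hij)) (hT ▸ hex)
      have hne : σ ≠ 0 := fun h' => by
        have := (h 0).2 h'.le
        rw [h₀] at this
        exact not_lt_bot this
      refine ⟨(true, σ - 1), by simp [cells]; omega, ?_⟩
      rintro ⟨_ | _, e⟩
      · have : t < p e ↔ σ - 1 < e := (h e).trans (by omega)
        rw [Bool.eq_iff_iff]
        simpa [joins, blt, Nat.blt_eq] using this
      · rfl
    · left
      rintro ⟨_ | _, e⟩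
      · simpa [joins, blt] using not_lt.1 fun h => hex (h.trans_le le_top)
      · rfl

lemma total_test_map {p : ℕ → P} {d d' : WordEnd P} {b b' : WordEnd ℕ}
    (h : ∀ e : WordEnd ℕ, joins blt (e.1, p e.2) d = joins Nat.blt e b)
    (h' : ∀ e : WordEnd ℕ, joins blt (e.1, p e.2) d' = joins Nat.blt e b') (X : List (Arc ℕ)) :
    total (test d d') (X.map (mapArc p)) = hits b b' X := by
  induction X with
  | nil => simp [total, hits]
  | cons x X ih =>
    simp only [total, hits, List.map_cons, List.sum_cons, List.countP_cons] at ih ⊢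
    rw [ih, test]
    simp only [mapArc, h, h']
    cases joins Nat.blt x.1 b <;> cases joins Nat.blt x.2 b' <;> simp [add_comm]

lemma total_test_eq_zero {p : ℕ → P} {d d' : WordEnd P}
    (h : (∀ e : WordEnd ℕ, joins blt (e.1, p e.2) d = false) ∨
      ∀ e : WordEnd ℕ, joins blt (e.1, p e.2) d' = false) (X : List (Arc ℕ)) :
    total (test d d') (X.map (mapArc p)) = 0 := by
  rw [total, List.map_map]
  refine List.sum_eq_zero fun y hy => ?_
  obtain ⟨x, -, rfl⟩ := List.mem_map.1 hy
  rcases h with h | h <;> simp [test, mapArc, h]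

lemma cast_sum_map {α : Type*} (c : List α) (f : α → ℕ) :
    (((c.map f).sum : ℕ) : ℝ) = (c.map fun e => (f e : ℝ)).sum := by
  rw [Nat.cast_list_sum, List.map_map]
  rfl

variable [BoundedOrder P]

lemma Cone.total_le {N T k : ℕ} {D : List (Arc ℕ)} {c : List (ℕ × ℕ × List (Arc ℕ))}
    (hc : covers N T k D c = true) {p : ℕ → P} (hp : Monotone p) (h₀ : p 0 = ⊥) (hT : p T = ⊤)
    {φ : Arc P → ℝ} (h : Cone φ) :
    N * total φ (D.map (mapArc p)) ≤
      (c.map fun e => (e.1 : ℝ) * total φ (e.2.2.map (mapArc p))).sum := by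
  induction h with
  | zero => simp [total, Function.comp_def]
  | test d d' =>
    rcases exists_index hp h₀ hT d with hd | ⟨b, hb, hd⟩
    · simp [total_test_eq_zero (.inl hd)]
    rcases exists_index hp h₀ hT d' with hd' | ⟨b', hb', hd'⟩
    · simp [total_test_eq_zero (.inr hd')]
    simp only [covers, Bool.and_eq_true, List.all_eq_true, Nat.ble_eq] at hc
    have := hc.1 b hb b' hb'
    simp_rw [total_test_map hd hd']
    replace this := (Nat.cast_le (α := ℝ)).2 this
    rw [cast_sum_map] at this
    push_cast at this
    exact this
  | add _ _ h h' =>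
    simp_rw [total_add, mul_add, List.sum_map_add]
    exact add_le_add h h'
  | smul a ha _ h =>
    simp_rw [total_smul, mul_left_comm _ a, List.sum_map_mul_left]
    exact mul_le_mul_of_nonneg_left h ha

lemma dominated_of_covers {N T k : ℕ} {D : List (Arc ℕ)} {c : List (ℕ × ℕ × List (Arc ℕ))}
    (hN : 0 < N) (hc : covers N T k D c = true) {p : ℕ → P} (hp : Monotone p) (h₀ : p 0 = ⊥)
    (hT : p T = ⊤) {o : Bool} (hg : ∀ e ∈ c, IsGen o e.2.1 (e.2.2.map (mapArc p))) :
    Dominated o k (D.map (mapArc p)) := by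
  intro φ hφ
  have h₁ := hφ.1.total_le hc hp h₀ hT
  simp only [covers, Bool.and_eq_true, List.all_eq_true, Nat.ble_eq] at hc
  have h₂ : ∀ e ∈ c, (e.1 : ℝ) * total φ (e.2.2.map (mapArc p)) ≤
      e.1 * cost (k - e.2.1) * (√6 ^ k / 3600000) := by
    intro e he
    rw [mul_assoc]
    refine mul_le_mul_of_nonneg_left ((hφ.2 _ _ (hg e he)).trans ?_) (by positivity)
    have := le_cost_mul_pow (k - e.2.1)
    have hk : √6 ^ k = √6 ^ (k - e.2.1) * √6 ^ e.2.1 := by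
      rw [← pow_add, Nat.sub_add_cancel (hc.2.1 e he)]
    rw [hk]
    have hs : 0 ≤ √6 ^ e.2.1 := by positivity
    nlinarith
  have h₃ := h₁.trans (List.sum_le_sum h₂)
  rw [List.sum_map_mul_right] at h₃
  have h₄ : ((c.map fun e => (e.1 : ℝ) * cost (k - e.2.1)).sum) ≤ N * 3600000 := by
    have := (Nat.cast_le (α := ℝ)).2 hc.2.2
    rw [cast_sum_map] at this
    push_cast at this
    exact this
  have hs : 0 ≤ √6 ^ k / 3600000 := by positivity
  have h₅ := h₃.trans (mul_le_mul_of_nonneg_right h₄ hs)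
  have hN' : (0 : ℝ) < N := by exact_mod_cast hN
  refine le_of_mul_le_mul_left (h₅.trans (le_of_eq ?_)) hN'
  ring

end Certificates

/-! ### Products of extremal families -/

section Tables

/-- The combination of odd families with coefficients, shapes and letters listed in `c`. -/
def oddCombination (T : ℕ) (c : List (ℕ × ℕ × ℕ)) : List (ℕ × ℕ × List (Arc ℕ)) :=
  c.map fun e => (e.1, e.2.1, oddAt 0 T e.2.1 e.2.2)

/-- The combination of even families with coefficients, shapes and letters listed in `c`. -/
def evenCombination (T : ℕ) (c : List (ℕ × ℕ × ℕ × ℕ)) : List (ℕ × ℕ × List (Arc ℕ)) :=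
  c.map fun e => (e.1, evenLevel e.2.1, evenAt 0 T e.2.1 e.2.2.1 e.2.2.2)

/-- Combinations of even families dominating the product of the odd families of shapes `i`, `j`
with letters `1`, `2`, at the index `3 * i + j`. -/
def oddOddTable : List (List (ℕ × ℕ × ℕ × ℕ)) :=
  [[(1, 5, 0, 0)], [(1, 0, 1, 2)], [(1, 2, 1, 2)],
   [(1, 1, 1, 2)], [(1, 4, 1, 2)], [(8, 5, 0, 0), (1, 4, 1, 2)],
   [(1, 3, 1, 2)], [(8, 5, 0, 0), (1, 4, 1, 2)], [(22, 5, 0, 0), (2, 0, 1, 2), (2, 1, 1, 2)]]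

/-- The positions of the letter of an odd family relative to the two letters of an even family. -/
def slot (r : ℕ) : ℕ × ℕ × ℕ := [(1, 2, 3), (2, 1, 3), (3, 1, 2)].getD r (0, 0, 0)

/-- Twice the combinations of odd families dominating the product of the odd family of shape `i`
and the even family of shape `s` with letters in the relative position `slot r`, at the index
`18 * i + 3 * s + r`. -/
def oddEvenTable : List (List (ℕ × ℕ × ℕ)) :=
  [[(12, 0, 0)],
   [(4, 1, 2)],
   [(2, 0, 1), (2, 0, 2), (6, 0, 3), (2, 0, 4)],
   [(8, 0, 0), (2, 0, 1), (2, 0, 3)],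
   [(4, 1, 2)],
   [(2, 0, 1), (4, 0, 2), (6, 0, 3)],
   [(20, 0, 0), (4, 0, 1), (4, 0, 2)],
   [(8, 0, 2), (2, 0, 3), (6, 0, 4), (4, 1, 1)],
   [(6, 0, 1), (2, 0, 2), (14, 0, 3), (6, 0, 4)],
   [(16, 0, 0), (6, 0, 1), (6, 0, 3)],
   [(8, 0, 0), (8, 0, 2), (4, 1, 3)],
   [(2, 0, 1), (8, 0, 2), (14, 0, 3), (4, 0, 4)],
   [(16, 0, 0), (4, 0, 1), (2, 0, 2), (2, 0, 3), (2, 1, 1)],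
   [(2, 0, 1), (4, 0, 2), (2, 0, 3), (6, 1, 2)],
   [(2, 0, 1), (4, 0, 2), (12, 0, 3), (6, 0, 4), (2, 1, 1)],
   [(2, 1, 1)],
   [(2, 1, 2)],
   [(2, 1, 3)],
   [(12, 0, 0), (4, 0, 1), (2, 0, 2), (2, 0, 3), (2, 1, 1)],
   [(2, 0, 1), (2, 0, 2), (2, 0, 3), (1, 1, 2), (3, 2, 2)],
   [(4, 0, 2), (4, 0, 3), (8, 0, 4), (4, 1, 1)],
   [(8, 0, 0), (4, 0, 1), (2, 0, 2), (2, 0, 3), (2, 1, 1), (2, 1, 3)],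
   [(2, 0, 1), (2, 0, 2), (2, 0, 3), (1, 1, 2), (3, 2, 2)],
   [(2, 0, 1), (8, 0, 2), (6, 0, 3), (4, 0, 4), (2, 1, 1)],
   [(20, 0, 0), (8, 0, 1), (8, 0, 2), (6, 1, 1), (4, 1, 3)],
   [(6, 0, 1), (6, 0, 2), (2, 0, 3), (8, 0, 4), (2, 1, 1), (8, 1, 2), (4, 2, 1)],
   [(4, 0, 1), (4, 0, 2), (8, 0, 3), (16, 0, 4), (8, 1, 1), (4, 1, 3)],
   [(16, 0, 0), (8, 0, 1), (2, 0, 2), (6, 0, 3), (6, 1, 1), (6, 1, 3)],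
   [(8, 0, 0), (2, 0, 1), (6, 0, 2), (6, 0, 3), (6, 1, 2), (4, 1, 3), (4, 2, 2)],
   [(16, 0, 2), (6, 0, 3), (14, 0, 4), (4, 1, 1), (6, 1, 3)],
   [(16, 0, 0), (8, 0, 1), (6, 0, 2), (2, 0, 3), (4, 1, 1), (4, 1, 3), (2, 2, 1)],
   [(4, 0, 1), (6, 0, 2), (4, 0, 3), (6, 1, 2), (2, 1, 3), (2, 2, 1), (4, 2, 2)],
   [(8, 0, 2), (8, 0, 3), (16, 0, 4), (6, 1, 1), (2, 1, 3), (2, 2, 1)],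
   [(2, 2, 1)],
   [(2, 2, 2)],
   [(2, 2, 3)],
   [(12, 0, 0), (4, 0, 1), (4, 0, 2), (6, 1, 3), (2, 2, 1), (2, 2, 2)],
   [(2, 0, 1), (2, 0, 2), (2, 0, 3), (2, 1, 2), (4, 1, 3), (4, 2, 1), (4, 2, 2)],
   [(4, 0, 2), (8, 0, 4), (6, 1, 1), (4, 1, 2), (4, 1, 3), (2, 2, 1)],
   [(8, 0, 0), (2, 0, 1), (2, 0, 2), (2, 1, 1), (4, 1, 2), (8, 1, 3), (2, 2, 1)],
   [(2, 0, 1), (2, 0, 2), (2, 0, 3), (2, 1, 2), (4, 1, 3), (4, 2, 1), (4, 2, 2)],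
   [(16, 0, 2), (2, 0, 3), (2, 0, 4), (4, 1, 1), (2, 1, 3), (4, 2, 1)],
   [(20, 0, 0), (8, 0, 1), (8, 0, 2), (6, 1, 2), (8, 1, 3), (6, 2, 1), (6, 2, 2)],
   [(6, 0, 1), (6, 0, 2), (2, 0, 3), (8, 0, 4), (2, 1, 1), (8, 1, 2), (4, 1, 3), (16, 2, 1)],
   [(4, 0, 1), (6, 0, 2), (2, 0, 3), (16, 0, 4), (10, 1, 1), (2, 1, 2), (10, 1, 3), (10, 2, 1)],
   [(16, 0, 0), (4, 0, 1), (4, 0, 2), (4, 0, 3), (2, 1, 2), (20, 1, 3), (10, 2, 1)],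
   [(8, 0, 0), (2, 0, 1), (4, 0, 2), (10, 0, 3), (14, 1, 3), (4, 2, 1), (12, 2, 2)],
   [(20, 0, 2), (6, 0, 3), (10, 0, 4), (8, 1, 2), (6, 1, 3), (8, 2, 1), (4, 2, 2)],
   [(16, 0, 0), (8, 0, 1), (6, 0, 2), (2, 0, 3), (12, 1, 3), (6, 2, 1), (8, 2, 2)],
   [(4, 0, 1), (6, 0, 2), (4, 0, 3), (2, 1, 2), (10, 1, 3), (10, 2, 1), (8, 2, 2)],
   [(12, 0, 2), (4, 0, 3), (16, 0, 4), (2, 1, 1), (4, 1, 2), (6, 1, 3), (14, 2, 1)],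
   [(8, 0, 0), (8, 0, 4), (2, 2, 1)],
   [(8, 0, 0), (8, 0, 4), (2, 2, 2)],
   [(8, 0, 0), (8, 0, 4), (2, 2, 3)]]

lemma oddOddTable_spec : ∀ i < 3, ∀ j < 3,
    covers 1 3 (i + j + 1) (glueAll Nat.blt (oddAt 0 3 i 1) (oddAt 0 3 j 2))
      (evenCombination 3 (oddOddTable.getD (3 * i + j) [])) = true ∧
    ∀ e ∈ oddOddTable.getD (3 * i + j) [], e.2.1 < 6 ∧ e.2.2.1 ≤ e.2.2.2 := by
  decide +kernel

lemma oddEvenTable_spec : ∀ i < 3, ∀ s < 6, ∀ r < 3,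
    covers 2 4 (i + evenLevel s) (glueAll Nat.blt (oddAt 0 4 i (slot r).1)
        (evenAt 0 4 s (slot r).2.1 (slot r).2.2))
      (oddCombination 4 (oddEvenTable.getD (18 * i + 3 * s + r) [])) = true ∧
    ∀ e ∈ oddEvenTable.getD (18 * i + 3 * s + r) [], e.2.1 < 3 := by
  decide +kernel

/-- The check that a family consists of `c` words with low left end and high right end and `c`
words with high left end and low right end, with `c * √6 ≤ √6 ^ k`. -/
def balanced (k : ℕ) (D : List (Arc ℕ)) : Bool :=
  D.all (fun x => xor x.1.1 x.2.1) &&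
    (Nat.beq (D.countP fun x => x.1.1) (D.countP fun x => x.2.1) &&
      (Nat.ble 1 k && Nat.ble ((D.countP fun x => x.1.1) * cost (k - 1)) 3600000))

/-- The relative positions of the letters of two even families. -/
def interleaving (r : ℕ) : ℕ × ℕ × ℕ × ℕ :=
  [(1, 2, 3, 4), (1, 3, 2, 4), (1, 4, 2, 3), (2, 3, 1, 4), (2, 4, 1, 3), (3, 4, 1, 2)].getD r
    (0, 0, 0, 0)

lemma balanced_even_even : ∀ s < 6, ∀ s' < s + 1, ∀ r < 6,
    balanced (evenLevel s + evenLevel s') (glueAll Nat.blt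
      (evenAt 0 5 s (interleaving r).1 (interleaving r).2.1)
      (evenAt 0 5 s' (interleaving r).2.2.1 (interleaving r).2.2.2)) = true := by
  decide +kernel

end Tables

section Products

variable {P : Type*} [LinearOrder P]

lemma total_glue_map_le {φ : Arc P → ℝ} (hφ : ∀ x, 0 ≤ φ x) {p : ℕ → P} (hp : Monotone p)
    (x y : Arc ℕ) : total φ (glue blt (mapArc p x) (mapArc p y)) ≤
      total φ ((glue Nat.blt x y).map (mapArc p)) := by
  have h : ∀ e d : WordEnd ℕ, joins blt (e.1, p e.2) (d.1, p d.2) = true →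
      joins Nat.blt e d = true := by
    rintro ⟨_ | _, e⟩ ⟨_ | _, d⟩ <;> simp [joins, blt, Nat.blt_eq] <;> exact hp.reflect_lt
  have h₁ := h x.2 y.1
  have h₂ := h y.2 x.1
  have h₃ := hφ (mapArc p (x.1, y.2))
  have h₄ := hφ (mapArc p (y.1, x.2))
  simp only [glue, mapArc, total] at *
  rcases h₅ : joins blt (x.2.1, p x.2.2) (y.1.1, p y.1.2) <;>
    rcases h₆ : joins blt (y.2.1, p y.2.2) (x.1.1, p x.1.2) <;>
    rcases h₇ : joins Nat.blt x.2 y.1 <;> rcases h₈ : joins Nat.blt y.2 x.1 <;>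
    simp_all [mapArc]
  all_goals positivity

lemma total_glueAll_map_le {φ : Arc P → ℝ} (hφ : ∀ x, 0 ≤ φ x) {p : ℕ → P} (hp : Monotone p)
    (X Y : List (Arc ℕ)) :
    total φ (glueAll blt (X.map (mapArc p)) (Y.map (mapArc p))) ≤
      total φ ((glueAll Nat.blt X Y).map (mapArc p)) := by
  rw [total_glueAll, glueAll, List.map_flatMap, total_flatMap, List.map_map]
  refine List.sum_le_sum fun x _ => ?_
  rw [Function.comp_apply, List.map_map, List.map_flatMap, total_flatMap]
  exact List.sum_le_sum fun y _ => total_glue_map_le hφ hp x y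

variable [BoundedOrder P]

lemma Dominated.of_map {o : Bool} {k : ℕ} {p : ℕ → P} (hp : Monotone p) {X Y : List (Arc ℕ)}
    (h : Dominated o k ((glueAll Nat.blt X Y).map (mapArc p))) :
    Dominated o k (glueAll blt (X.map (mapArc p)) (Y.map (mapArc p))) :=
  fun φ hφ => (total_glueAll_map_le hφ.1.nonneg hp X Y).trans (h φ hφ)

lemma Cone.le_extreme {φ : Arc P → ℝ} (h : Cone φ) (x : Arc P) :
    φ x ≤ φ ((x.1.1, bif x.1.1 then ⊥ else ⊤), (x.2.1, bif x.2.1 then ⊥ else ⊤)) := by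
  induction h with
  | zero => rfl
  | test d d' =>
    have key : ∀ e d : WordEnd P, joins blt e d = true →
        joins blt (e.1, bif e.1 then ⊥ else ⊤) d = true := by
      rintro ⟨_ | _, e⟩ ⟨_ | _, d⟩ <;> simp only [joins, blt, cond_true, cond_false,
        decide_eq_true_eq, Bool.false_eq_true, false_imp_iff]
      · exact fun h => h.trans_le le_top
      · exact fun h => bot_le.trans_lt h
    have h₁ := key x.1 d
    have h₂ := key x.2 d'
    by_cases hx : joins blt x.1 d = true ∧ joins blt x.2 d' = true
    · simp [AltGrowth.test, hx, h₁ hx.1, h₂ hx.2]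
    · refine le_trans (le_of_eq ?_) (test_nonneg _ _ _)
      rw [← Bool.and_eq_true, Bool.not_eq_true] at hx
      simp only [AltGrowth.test, hx, cond_false]
  | add _ _ h h' => exact add_le_add h h'
  | smul c hc _ h => exact mul_le_mul_of_nonneg_left h hc

lemma Cone.total_le_of_opposite {φ : Arc P → ℝ} (h : Cone φ) (p : ℕ → P) (D : List (Arc ℕ))
    (hD : ∀ x ∈ D, xor x.1.1 x.2.1 = true) :
    total φ (D.map (mapArc p)) ≤
      (D.countP fun x => x.1.1) * φ ((true, ⊥), (false, ⊤)) +
        (D.countP fun x => x.2.1) * φ ((false, ⊤), (true, ⊥)) := by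
  induction D with
  | nil => simp [total]
  | cons x D ih =>
    have h₁ := h.le_extreme (mapArc p x)
    have h₂ := ih fun y hy => hD y (List.mem_cons_of_mem _ hy)
    have h₃ := hD x List.mem_cons_self
    simp only [total, List.map_cons, List.sum_cons, List.countP_cons, List.map_map] at h₂ ⊢
    obtain ⟨⟨_ | _, a⟩, ⟨_ | _, b⟩⟩ := x <;> simp [mapArc] at h₁ h₃ ⊢ <;> linarith

lemma pair_eq_evenAt (x y : P) : pair ⊥ ⊤ = evenAt ⊥ ⊤ 5 x y := rfl

lemma dominated_of_balanced {k : ℕ} {D : List (Arc ℕ)} (h : balanced k D = true) (p : ℕ → P) :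
    Dominated false k (D.map (mapArc p)) := by
  intro φ hφ
  simp only [balanced, Bool.and_eq_true, List.all_eq_true, Nat.ble_eq, Nat.beq_eq] at h
  obtain ⟨h₁, h₂, h₃, h₄⟩ := h
  have h₅ := hφ.1.total_le_of_opposite p D h₁
  have h₆ := hφ.2 _ _ (.even (s := 5) (by norm_num) (le_refl (⊥ : P)))
  rw [← pair_eq_evenAt, show evenLevel 5 = 1 from rfl] at h₆
  simp only [total, pair, List.map_cons, List.map_nil, List.sum_cons, List.sum_nil, add_zero,
    pow_one] at h₆
  rw [← h₂, ← mul_add] at h₅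
  set c := D.countP fun x => x.1.1
  have h₇ := le_cost_mul_pow (k - 1)
  have h₈ : (c : ℝ) * cost (k - 1) ≤ 3600000 := by exact_mod_cast h₄
  have h₉ : √6 ^ k = √6 ^ (k - 1) * √6 := by rw [← pow_succ, Nat.sub_add_cancel h₃]
  have hs : (0 : ℝ) < √6 := by positivity
  have hc : (0 : ℝ) ≤ c := by positivity
  have hp : (0 : ℝ) ≤ √6 ^ (k - 1) := by positivity
  rw [h₉]
  refine (h₅.trans (mul_le_mul_of_nonneg_left h₆ hc)).trans
    (mul_le_mul_of_nonneg_right ?_ hs.le)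
  have h₁₀ := mul_le_mul_of_nonneg_right h₈ hp
  have h₁₁ := mul_le_mul_of_nonneg_left h₇ hc
  nlinarith

lemma monotone_place {l : List P} (h : l.Pairwise (· ≤ ·)) : Monotone (place l ⊤) := by
  induction l with
  | nil => exact fun i j _ => le_of_eq (by simp [place])
  | cons a l ih =>
    rw [List.pairwise_cons] at h
    intro i j hij
    have key : ∀ j, a ≤ place l ⊤ j := by
      intro j
      rw [place, List.getD_eq_getElem?_getD]
      rcases lt_or_ge j l.length with hj | hj
      · rw [List.getElem?_eq_getElem hj]
        exact h.1 _ (List.getElem_mem hj)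
      · rw [List.getElem?_eq_none hj]
        exact le_top
    rcases i with _ | i <;> rcases j with _ | j
    · exact le_rfl
    · simpa [place] using key j
    · omega
    · simpa [place] using ih h.2 (Nat.le_of_succ_le_succ hij)

lemma dominated_odd_odd {i j : ℕ} (hi : i < 3) (hj : j < 3) {z z' : P} (h : z ≤ z') :
    Dominated false (i + j + 1) (glueAll blt (oddAt ⊥ ⊤ i z) (oddAt ⊥ ⊤ j z')) := by
  obtain ⟨hc, hv⟩ := oddOddTable_spec i hi j hj
  have hp : Monotone (place [⊥, z, z'] ⊤) := monotone_place (by simp [h])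
  have := dominated_of_covers (o := false) one_pos hc hp rfl rfl (by
    simp only [evenCombination, List.mem_map]
    rintro _ ⟨e, he, rfl⟩
    rw [map_evenAt]
    exact .even (hv e he).1 (hp (hv e he).2))
  have := this.of_map hp
  rwa [map_oddAt, map_oddAt] at this

lemma dominated_odd_even_of_place {i s r : ℕ} (hi : i < 3) (hs : s < 6) (hr : r < 3)
    {l : List P} (hl : (⊥ :: l).Pairwise (· ≤ ·)) (hlen : l.length = 3) :
    Dominated true (i + evenLevel s)
      (glueAll blt (oddAt ⊥ ⊤ i (place (⊥ :: l) ⊤ (slot r).1))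
        (evenAt ⊥ ⊤ s (place (⊥ :: l) ⊤ (slot r).2.1) (place (⊥ :: l) ⊤ (slot r).2.2))) := by
  obtain ⟨hc, hv⟩ := oddEvenTable_spec i hi s hs r hr
  have hp : Monotone (place (⊥ :: l) ⊤) := monotone_place hl
  have h₀ : place (⊥ :: l) ⊤ 0 = ⊥ := rfl
  have hT : place (⊥ :: l) ⊤ 4 = ⊤ := by simp [place, hlen]
  have := dominated_of_covers (o := true) two_pos hc hp h₀ hT (by
    simp only [oddCombination, List.mem_map]
    rintro _ ⟨e, he, rfl⟩
    rw [map_oddAt, h₀, hT]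
    exact .odd (hv e he) _)
  have := this.of_map hp
  rwa [map_oddAt, map_evenAt, h₀, hT] at this

lemma dominated_odd_even {i s : ℕ} (hi : i < 3) (hs : s < 6) (z : P) {x y : P} (h : x ≤ y) :
    Dominated true (i + evenLevel s) (glueAll blt (oddAt ⊥ ⊤ i z) (evenAt ⊥ ⊤ s x y)) := by
  rcases le_total z x with hx | hx
  · exact dominated_odd_even_of_place (r := 0) (l := [z, x, y]) hi hs (by norm_num)
      (by simp [*, hx.trans h]) rfl
  rcases le_total z y with hy | hy
  · exact dominated_odd_even_of_place (r := 1) (l := [x, z, y]) hi hs (by norm_num)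
      (by simp [*]) rfl
  · exact dominated_odd_even_of_place (r := 2) (l := [x, y, z]) hi hs (by norm_num)
      (by simp [*]) rfl

lemma dominated_even_even_of_place {s s' r : ℕ} (hs : s < 6) (hs' : s' < s + 1) (hr : r < 6)
    {l : List P} (hl : (⊥ :: l).Pairwise (· ≤ ·)) (hlen : l.length = 4) :
    Dominated false (evenLevel s + evenLevel s')
      (glueAll blt
        (evenAt ⊥ ⊤ s (place (⊥ :: l) ⊤ (interleaving r).1)
          (place (⊥ :: l) ⊤ (interleaving r).2.1))
        (evenAt ⊥ ⊤ s' (place (⊥ :: l) ⊤ (interleaving r).2.2.1)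
          (place (⊥ :: l) ⊤ (interleaving r).2.2.2))) := by
  have hp : Monotone (place (⊥ :: l) ⊤) := monotone_place hl
  have h₀ : place (⊥ :: l) ⊤ 0 = ⊥ := rfl
  have hT : place (⊥ :: l) ⊤ 5 = ⊤ := by simp [place, hlen]
  have := dominated_of_balanced (balanced_even_even s hs s' hs' r hr) (place (⊥ :: l) ⊤)
  have := this.of_map hp
  rwa [map_evenAt, map_evenAt, h₀, hT] at this

lemma dominated_even_even_of_le {s s' : ℕ} (hs : s < 6) (hs' : s' < s + 1) {x y x' y' : P}
    (h : x ≤ y) (h' : x' ≤ y') :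
    Dominated false (evenLevel s + evenLevel s')
      (glueAll blt (evenAt ⊥ ⊤ s x y) (evenAt ⊥ ⊤ s' x' y')) := by
  rcases le_total x x' with hx | hx
  · rcases le_total y x' with h₁ | h₁
    · exact dominated_even_even_of_place (r := 0) (l := [x, y, x', y']) hs hs' (by norm_num)
        (by simp [*, h₁.trans h', hx.trans h']) rfl
    rcases le_total y y' with h₂ | h₂
    · exact dominated_even_even_of_place (r := 1) (l := [x, x', y, y']) hs hs' (by norm_num)
        (by simp [*, hx.trans h']) rfl
    · exact dominated_even_even_of_place (r := 2) (l := [x, x', y', y]) hs hs' (by norm_num)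
        (by simp [*, hx.trans h']) rfl
  · rcases le_total y' x with h₁ | h₁
    · exact dominated_even_even_of_place (r := 5) (l := [x', y', x, y]) hs hs' (by norm_num)
        (by simp [*, h₁.trans h, hx.trans h]) rfl
    rcases le_total y y' with h₂ | h₂
    · exact dominated_even_even_of_place (r := 3) (l := [x', x, y, y']) hs hs' (by norm_num)
        (by simp [*, hx.trans h]) rfl
    · exact dominated_even_even_of_place (r := 4) (l := [x', x, y', y]) hs hs' (by norm_num)
        (by simp [*, hx.trans h]) rfl

lemma dominated_even_even {s s' : ℕ} (hs : s < 6) (hs' : s' < 6) {x y x' y' : P}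
    (h : x ≤ y) (h' : x' ≤ y') :
    Dominated false (evenLevel s + evenLevel s')
      (glueAll blt (evenAt ⊥ ⊤ s x y) (evenAt ⊥ ⊤ s' x' y')) := by
  rcases lt_or_ge s' (s + 1) with hlt | hge
  · exact dominated_even_even_of_le hs hlt h h'
  · rw [add_comm]
    exact (dominated_even_even_of_le hs' (by omega) h' h).glueAll_comm

/-- Domination is preserved by gluing; two odd families gain one level. -/
lemma Dominated.node {o o' : Bool} {k m : ℕ} {X Y : List (Arc P)} (hX : Dominated o k X)
    (hY : Dominated o' m Y) :
    Dominated (xor o o') (k + m + (o && o').toNat) (glueAll blt X Y) := by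
  refine hX.bilinear hY fun k' X' m' Y' hX' hY' => ?_
  cases hX' with
  | odd hi z =>
    cases hY' with
    | odd hj z' =>
      rcases le_total z z' with h | h
      · exact dominated_odd_odd hi hj h
      · have := (dominated_odd_odd hj hi h).glueAll_comm
        rwa [add_comm m' k'] at this
    | even hs h => exact dominated_odd_even hi hs z h
  | even hs h =>
    cases hY' with
    | odd hj z' =>
      have := (dominated_odd_even hj hs z' h).glueAll_comm
      rwa [add_comm] at this
    | even hs' h' => exact dominated_even_even hs hs' h h'

lemma dominated_letter (z : P) : Dominated true 0 (letter z) := fun _ hφ =>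
  hφ.2 _ _ (.odd (i := 0) (by norm_num) z)

/-- The number of words in a dominated family of words with proper ends is bounded. -/
lemma Dominated.length_le {o : Bool} {k : ℕ} {X : List (Arc P)} (h : Dominated o k X)
    (hX : ∀ x ∈ X, (⊥ < x.1.2 ∧ x.1.2 < ⊤) ∧ (⊥ < x.2.2 ∧ x.2.2 < ⊤)) :
    (X.length : ℝ) ≤ 80 * √6 ^ k := by
  set φ : Arc P → ℝ := fun x => (1 / 80) *
    ((test (true, ⊥) (true, ⊥) x + test (true, ⊥) (false, ⊤) x) +
      (test (false, ⊤) (true, ⊥) x + test (false, ⊤) (false, ⊤) x))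
  have hφ : Cone φ := .smul _ (by norm_num)
    (.add (.add (.test _ _) (.test _ _)) (.add (.test _ _) (.test _ _)))
  have test_le : ∀ (d d' : WordEnd P) x, test d d' x ≤ 1 := by
    intro d d' x
    unfold test
    cases joins blt x.1 d && joins blt x.2 d' <;> simp
  have h₁ : ∀ x, φ x ≤ 1 / 20 := by
    intro x
    have h₁ := test_le (true, ⊥) (true, ⊥) x
    have h₂ := test_le (true, ⊥) (false, ⊤) x
    have h₃ := test_le (false, ⊤) (true, ⊥) x
    have h₄ := test_le (false, ⊤) (false, ⊤) x
    simp only [φ]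
    linarith
  have h₂ : ∀ k (Y : List (Arc P)), IsGen o k Y → (Y.length : ℝ) ≤ 20 := by
    intro k Y hY
    have h₃ : ∀ i < 3, (oddPattern i).length ≤ 20 := by decide +kernel
    have h₄ : ∀ i < 6, (evenPattern i).length ≤ 20 := by decide +kernel
    cases hY with
    | odd hi z => simpa [oddAt] using h₃ _ hi
    | even hs _ => simpa [evenAt] using h₄ _ hs
  have h₃ := h φ ⟨hφ, fun k' Y hY => by
    have h₄ : total φ Y ≤ Y.length * (1 / 20) := by
      have := List.sum_le_card_nsmul (Y.map φ) (1 / 20) (by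
        intro y hy
        obtain ⟨x, -, rfl⟩ := List.mem_map.1 hy
        exact h₁ x)
      simpa [total] using this
    have h₅ := h₂ k' Y hY
    have h₆ : (1 : ℝ) ≤ √6 ^ k' := one_le_pow₀ (Real.one_le_sqrt.2 (by norm_num))
    linarith⟩
  have h₄ : X.length * (1 / 80) ≤ total φ X := by
    have := List.card_nsmul_le_sum (X.map φ) (1 / 80) (by
      intro y hy
      obtain ⟨⟨⟨b, x⟩, ⟨b', x'⟩⟩, hx, rfl⟩ := List.mem_map.1 hy
      obtain ⟨⟨h₁, h₂⟩, h₃, h₄⟩ := hX _ hx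
      simp only at h₁ h₂ h₃ h₄
      cases b <;> cases b' <;> simp [φ, test, joins, blt, h₁, h₂, h₃, h₄])
    simpa [total] using this
  linarith

end Products

/-! ### Tagged alternating words -/

/-- A word with its letters tagged as low or high is a zigzag if consecutive letters can be
glued. -/
def Zigzag (w : List (WordEnd ℕ)) : Prop := w.IsChain fun e d => joins blt e d = true

lemma isAlternating_tail {a : ℕ} {w : List ℕ} (h : IsAlternating (a :: w)) : IsAlternating w :=
  ⟨fun i hi => by simpa using h.1 (i + 1) (by simpa using hi),
    fun i hi => by simpa using h.2 (i + 1) (by simp only [List.length_cons]; omega)⟩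

lemma exists_zigzag {w : List ℕ} (h : IsAlternating w) :
    ∃ T : List (WordEnd ℕ), Zigzag T ∧ T.map Prod.snd = w := by
  induction w with
  | nil => exact ⟨[], .nil, rfl⟩
  | cons a w ih =>
    obtain ⟨T, hT, rfl⟩ := ih (isAlternating_tail h)
    rcases T with _ | ⟨⟨c, b⟩, _ | ⟨⟨c', d⟩, T⟩⟩
    · exact ⟨[(true, a)], .singleton _, rfl⟩
    · have hab : a ≠ b := by simpa using h.1 0 (by simp)
      rcases hab.lt_or_gt with hab | hab
      · exact ⟨[(true, a), (false, b)], by simp [Zigzag, joins, blt, hab], rfl⟩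
      · exact ⟨[(false, a), (true, b)], by simp [Zigzag, joins, blt, hab], rfl⟩
    · have hab : a ≠ b := by simpa using h.1 0 (by simp)
      have habd := h.2 0 (by simp)
      simp only [List.map_cons, List.getD_cons_zero, List.getD_cons_succ, zero_add] at habd
      refine ⟨(!c, a) :: (c, b) :: (c', d) :: T, List.isChain_cons_cons.2 ⟨?_, hT⟩, rfl⟩
      have hbd := (List.isChain_cons_cons.1 hT).1
      cases c <;> cases c' <;> simp [joins, blt] at hbd ⊢ <;> omega

lemma Zigzag.isAlternating {T : List (WordEnd ℕ)} (h : Zigzag T) :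
    IsAlternating (T.map Prod.snd) := by
  have key : ∀ i (hi : i + 1 < T.length), joins blt T[i] T[i + 1] = true :=
    fun i hi => List.isChain_iff_getElem.1 h i hi
  have hget : ∀ i (hi : i < T.length), (T.map Prod.snd).getD i 0 = T[i].2 := by
    intro i hi
    simp [List.getD_eq_getElem?_getD, hi]
  refine ⟨fun i hi => ?_, fun i hi => ?_⟩
  · rw [List.length_map] at hi
    have h₁ := key i hi
    rw [hget i (by omega), hget (i + 1) hi]
    generalize T[i] = e at *
    generalize T[i + 1] = d at *
    obtain ⟨_ | _, e⟩ := e <;> obtain ⟨_ | _, d⟩ := d <;> simp [joins, blt] at h₁ ⊢ <;> omega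
  · rw [List.length_map] at hi
    have h₁ := key i (by omega)
    have h₂ := key (i + 1) hi
    rw [hget i (by omega), hget (i + 1) (by omega), hget (i + 2) hi]
    simp only [show i + 1 + 1 = i + 2 from rfl] at h₂
    generalize T[i] = e at *
    generalize T[i + 1] = d at *
    generalize T[i + 2] = f at *
    obtain ⟨_ | _, e⟩ := e <;> obtain ⟨_ | _, d⟩ := d <;> obtain ⟨_ | _, f⟩ := f <;>
      simp [joins, blt] at h₁ h₂ ⊢ <;> omega

/-- The ends of a tagged word. -/
def ends (w : List (WordEnd ℕ)) : Arc ℕ := (w.headD (true, 0), w.getLastD (true, 0))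

/-- The tagged zigzag words in the expansion set of a tree. -/
def tagged : BTree → List (List (WordEnd ℕ))
  | .leaf a => [[(true, a)], [(false, a)]]
  | .node l r => (tagged l).flatMap fun x => (tagged r).flatMap fun y =>
      (bif joins blt (ends x).2 (ends y).1 then [x ++ y] else []) ++
        (bif joins blt (ends y).2 (ends x).1 then [y ++ x] else [])

lemma ends_append {x y : List (WordEnd ℕ)} (hx : x ≠ []) (hy : y ≠ []) :
    ends (x ++ y) = ((ends x).1, (ends y).2) := by
  obtain ⟨a, x, rfl⟩ := List.exists_cons_of_ne_nil hx
  obtain ⟨y, b, rfl⟩ := List.eq_nil_or_concat y |>.resolve_left hy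
  rw [List.concat_eq_append, ← List.append_assoc, ends, ends, ends, List.getLastD_concat,
    List.getLastD_concat]
  rfl

lemma ne_nil_of_mem_tagged {t : BTree} {w : List (WordEnd ℕ)} (h : w ∈ tagged t) : w ≠ [] := by
  induction t generalizing w with
  | leaf a => rintro rfl; simp [tagged] at h
  | node l r ihl ihr =>
    simp only [tagged, List.mem_flatMap, List.mem_append] at h
    obtain ⟨x, hx, y, hy, h⟩ := h
    have := ihl hx
    rcases h₁ : joins blt (ends x).2 (ends y).1 <;> rcases h₂ : joins blt (ends y).2 (ends x).1 <;>
      simp [h₁, h₂] at h <;> rcases h with rfl | rfl <;> simp [this]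

lemma ne_nil_of_mem_words {t : BTree} {w : List ℕ} (h : w ∈ t.words) : w ≠ [] := by
  induction t generalizing w with
  | leaf a => rintro rfl; simp [BTree.words] at h
  | node l r ihl ihr =>
    simp only [BTree.words, Finset.mem_union, Finset.mem_image, Finset.mem_product] at h
    rcases h with ⟨⟨u, v⟩, ⟨hu, hv⟩, rfl⟩ | ⟨⟨u, v⟩, ⟨hu, hv⟩, rfl⟩ <;> simp [ihl hu]

lemma Zigzag.of_append {x y : List (WordEnd ℕ)} (h : Zigzag (x ++ y)) (hx : x ≠ []) (hy : y ≠ []) :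
    Zigzag x ∧ Zigzag y ∧ joins blt (ends x).2 (ends y).1 = true := by
  obtain ⟨h₁, h₂, h₃⟩ := List.isChain_append.1 h
  obtain ⟨x, a, rfl⟩ := List.eq_nil_or_concat x |>.resolve_left hx
  obtain ⟨b, y, rfl⟩ := List.exists_cons_of_ne_nil hy
  exact ⟨h₁, h₂, by simpa [ends] using h₃⟩

lemma mem_tagged {t : BTree} {T : List (WordEnd ℕ)} (hT : Zigzag T)
    (h : T.map Prod.snd ∈ t.words) : T ∈ tagged t := by
  induction t generalizing T with
  | leaf a =>
    simp only [BTree.words, Finset.mem_singleton, List.map_eq_singleton_iff] at h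
    obtain ⟨⟨_ | _, b⟩, rfl, rfl⟩ := h <;> simp [tagged]
  | node l r ihl ihr =>
    simp only [BTree.words, Finset.mem_union, Finset.mem_image, Finset.mem_product] at h
    simp only [tagged, List.mem_flatMap, List.mem_append]
    rcases h with ⟨⟨u, v⟩, ⟨hu, hv⟩, h⟩ | ⟨⟨u, v⟩, ⟨hu, hv⟩, h⟩
    · obtain ⟨x, y, rfl, rfl, rfl⟩ := List.map_eq_append_iff.1 h.symm
      have hx : x ≠ [] := by simpa using ne_nil_of_mem_words hu
      have hy : y ≠ [] := by simpa using ne_nil_of_mem_words hv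
      obtain ⟨h₁, h₂, h₃⟩ := hT.of_append hx hy
      exact ⟨x, ihl h₁ hu, y, ihr h₂ hv, .inl (by simp [h₃])⟩
    · obtain ⟨y, x, rfl, rfl, rfl⟩ := List.map_eq_append_iff.1 h.symm
      have hx : x ≠ [] := by simpa using ne_nil_of_mem_words hu
      have hy : y ≠ [] := by simpa using ne_nil_of_mem_words hv
      obtain ⟨h₂, h₁, h₃⟩ := hT.of_append hy hx
      exact ⟨x, ihl h₁ hu, y, ihr h₂ hv, .inr (by simp [h₃])⟩

lemma altCount_le_length_tagged (t : BTree) : altCount t ≤ (tagged t).length := by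
  calc altCount t ≤ ((tagged t).map (List.map Prod.snd)).toFinset.card := by
        refine Finset.card_le_card fun w hw => ?_
        obtain ⟨h₁, h₂⟩ := Finset.mem_filter.1 hw
        obtain ⟨T, hT, rfl⟩ := exists_zigzag h₂
        exact List.mem_toFinset.2 (List.mem_map_of_mem (mem_tagged hT h₁))
    _ ≤ ((tagged t).map (List.map Prod.snd)).length := List.toFinset_card_le _
    _ = (tagged t).length := List.length_map _

/-- The ends of a tagged word, with letters embedded in a bounded order. -/
def boundedEnds (w : List (WordEnd ℕ)) : Arc (WithBot (WithTop ℕ)) :=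
  mapArc (fun a : ℕ => ((a : WithTop ℕ) : WithBot (WithTop ℕ))) (ends w)

lemma joins_boundedEnds (x y : List (WordEnd ℕ)) :
    joins blt (boundedEnds x).2 (boundedEnds y).1 = joins blt (ends x).2 (ends y).1 := by
  simp [boundedEnds, mapArc, joins, blt]

lemma map_boundedEnds_tagged (l r : BTree) :
    (tagged (.node l r)).map boundedEnds =
      glueAll blt ((tagged l).map boundedEnds) ((tagged r).map boundedEnds) := by
  rw [tagged, glueAll, List.map_flatMap, List.flatMap_map]
  refine List.flatMap_congr fun x hx => ?_
  rw [List.map_flatMap, List.flatMap_map]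
  refine List.flatMap_congr fun y hy => ?_
  have h₁ := ends_append (ne_nil_of_mem_tagged hx) (ne_nil_of_mem_tagged hy)
  have h₂ := ends_append (ne_nil_of_mem_tagged hy) (ne_nil_of_mem_tagged hx)
  rw [glue, joins_boundedEnds, joins_boundedEnds]
  cases joins blt (ends x).2 (ends y).1 <;> cases joins blt (ends y).2 (ends x).1 <;>
    simp [boundedEnds, h₁, h₂, mapArc]

lemma dominated_tagged (t : BTree) :
    Dominated (t.leaves.length % 2 == 1) (t.leaves.length / 2) ((tagged t).map boundedEnds) := by
  induction t with
  | leaf a =>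
    simpa [BTree.leaves, tagged, boundedEnds, ends, mapArc, letter] using
      dominated_letter ((a : WithTop ℕ) : WithBot (WithTop ℕ))
  | node l r ihl ihr =>
    rw [map_boundedEnds_tagged, BTree.leaves, List.length_append]
    convert ihl.node ihr using 1
    · rcases Nat.mod_two_eq_zero_or_one l.leaves.length with h | h <;>
        rcases Nat.mod_two_eq_zero_or_one r.leaves.length with h' | h' <;>
        simp [Nat.add_mod, h, h']
    · rcases Nat.mod_two_eq_zero_or_one l.leaves.length with h | h <;>
        rcases Nat.mod_two_eq_zero_or_one r.leaves.length with h' | h' <;>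
        simp [h, h'] <;> omega

/-- The number of alternating words in the expansion of a tree with `n` leaves is at most a
constant times `6 ^ (n / 4)`. -/
lemma altCount_le (t : BTree) : (altCount t : ℝ) ≤ 80 * √6 ^ (t.leaves.length / 2) := by
  have h₁ : (altCount t : ℝ) ≤ (tagged t).length := by
    exact_mod_cast altCount_le_length_tagged t
  have h₂ := (dominated_tagged t).length_le (by
    intro x hx
    obtain ⟨w, -, rfl⟩ := List.mem_map.1 hx
    simp [boundedEnds, mapArc, WithBot.bot_lt_coe, ← WithBot.coe_top])
  rw [List.length_map] at h₂
  exact h₁.trans h₂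

/-! ### Trees with many alternating words -/

lemma append_mem_words {t : BTree} {w : List ℕ} (h : w ∈ t.words) (a : ℕ) :
    w ++ [a] ∈ (BTree.node t (.leaf a)).words := by
  simp only [BTree.words, Finset.mem_union, Finset.mem_image, Finset.mem_product]
  exact .inl ⟨(w, [a]), ⟨h, Finset.mem_singleton_self _⟩, rfl⟩

lemma cons_mem_words {t : BTree} {w : List ℕ} (h : w ∈ t.words) (a : ℕ) :
    a :: w ∈ (BTree.node t (.leaf a)).words := by
  simp only [BTree.words, Finset.mem_union, Finset.mem_image, Finset.mem_product]
  exact .inr ⟨(w, [a]), ⟨h, Finset.mem_singleton_self _⟩, rfl⟩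

lemma reverse_mem_words {t : BTree} {w : List ℕ} (h : w ∈ t.words) : w.reverse ∈ t.words := by
  induction t generalizing w with
  | leaf a => simp_all [BTree.words]
  | node l r ihl ihr =>
    simp only [BTree.words, Finset.mem_union, Finset.mem_image, Finset.mem_product] at h ⊢
    rcases h with ⟨⟨u, v⟩, ⟨hu, hv⟩, rfl⟩ | ⟨⟨u, v⟩, ⟨hu, hv⟩, rfl⟩
    · exact .inr ⟨(u.reverse, v.reverse), ⟨ihl hu, ihr hv⟩, by simp⟩
    · exact .inl ⟨(u.reverse, v.reverse), ⟨ihl hu, ihr hv⟩, by simp⟩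

lemma perm_leaves_of_mem_words {t : BTree} {w : List ℕ} (h : w ∈ t.words) : w.Perm t.leaves := by
  induction t generalizing w with
  | leaf a => simp_all [BTree.words, BTree.leaves]
  | node l r ihl ihr =>
    simp only [BTree.words, Finset.mem_union, Finset.mem_image, Finset.mem_product] at h
    rcases h with ⟨⟨u, v⟩, ⟨hu, hv⟩, rfl⟩ | ⟨⟨u, v⟩, ⟨hu, hv⟩, rfl⟩
    · exact (ihl hu).append (ihr hv)
    · exact List.perm_append_comm.trans ((ihl hu).append (ihr hv))

lemma zigzag_cons {e : WordEnd ℕ} {w : List (WordEnd ℕ)} (hw : w ≠ []) :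
    Zigzag (e :: w) ↔ joins blt e (ends w).1 = true ∧ Zigzag w := by
  obtain ⟨a, w, rfl⟩ := List.exists_cons_of_ne_nil hw
  exact List.isChain_cons_cons

lemma Zigzag.reverse {w : List (WordEnd ℕ)} (h : Zigzag w) : Zigzag w.reverse := by
  rw [Zigzag, List.isChain_reverse]
  exact h.imp fun a b hab => by rwa [joins_comm]

lemma ends_cons (e : WordEnd ℕ) {w : List (WordEnd ℕ)} (hw : w ≠ []) :
    ends (e :: w) = (e, (ends w).2) :=
  ends_append (x := [e]) (by simp) hw

lemma ends_reverse (w : List (WordEnd ℕ)) : ends w.reverse = (ends w).swap := by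
  simp [ends, List.headD_eq_head?_getD, List.getLastD_eq_getLast?]

lemma ends_snd_mem {w : List (WordEnd ℕ)} (hw : w ≠ []) :
    (ends w).1.2 ∈ w.map Prod.snd ∧ (ends w).2.2 ∈ w.map Prod.snd := by
  constructor
  · obtain ⟨a, w, rfl⟩ := List.exists_cons_of_ne_nil hw
    simp [ends]
  · obtain ⟨w, a, rfl⟩ := List.eq_nil_or_concat w |>.resolve_left hw
    simp [ends]

/-- The word `w` has a zigzag tagging whose ends have the tags `a` and `b`. -/
def HasZigzag (a b : Bool) (w : List ℕ) : Prop :=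
  ∃ T : List (WordEnd ℕ), T ≠ [] ∧ Zigzag T ∧ T.map Prod.snd = w ∧
    (ends T).1.1 = a ∧ (ends T).2.1 = b

lemma HasZigzag.reverse {a b : Bool} {w : List ℕ} (h : HasZigzag a b w) :
    HasZigzag b a w.reverse := by
  obtain ⟨T, hne, hT, rfl, ha, hb⟩ := h
  exact ⟨T.reverse, by simpa using hne, hT.reverse, by simp, by simp [ends_reverse, hb],
    by simp [ends_reverse, ha]⟩

lemma HasZigzag.cons_low {b : Bool} {w : List ℕ} (h : HasZigzag false b w) {x : ℕ}
    (hx : ∀ y ∈ w, x < y) : HasZigzag true b (x :: w) := by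
  obtain ⟨T, hne, hT, rfl, ha, hb⟩ := h
  have := hx _ (ends_snd_mem hne).1
  exact ⟨(true, x) :: T, by simp, (zigzag_cons hne).2 ⟨by simp [joins, ha, blt, this], hT⟩, rfl,
    by simp [ends_cons _ hne], by simp [ends_cons _ hne, hb]⟩

lemma HasZigzag.cons_high {b : Bool} {w : List ℕ} (h : HasZigzag true b w) {x : ℕ}
    (hx : ∀ y ∈ w, y < x) : HasZigzag false b (x :: w) := by
  obtain ⟨T, hne, hT, rfl, ha, hb⟩ := h
  have := hx _ (ends_snd_mem hne).1
  exact ⟨(false, x) :: T, by simp, (zigzag_cons hne).2 ⟨by simp [joins, ha, blt, this], hT⟩, rfl,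
    by simp [ends_cons _ hne], by simp [ends_cons _ hne, hb]⟩

lemma HasZigzag.cons_cons {b : Bool} {w : List ℕ} (h : HasZigzag true b w) {x y : ℕ}
    (hy : ∀ z ∈ w, z < y) (hxy : x < y) : HasZigzag true b (x :: y :: w) := by
  obtain ⟨T, hne, hT, rfl, ha, hb⟩ := h
  have := hy _ (ends_snd_mem hne).1
  refine ⟨(true, x) :: (false, y) :: T, by simp, (zigzag_cons (by simp)).2 ⟨?_,
    (zigzag_cons hne).2 ⟨by simp [joins, ha, blt, this], hT⟩⟩, rfl, rfl, ?_⟩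
  · simp [joins, blt, ends, hxy]
  · simp [ends_cons, hne, hb]

lemma HasZigzag.concat_high {a : Bool} {w : List ℕ} (h : HasZigzag a true w) {x : ℕ}
    (hx : ∀ y ∈ w, y < x) : HasZigzag a false (w ++ [x]) := by
  simpa using (h.reverse.cons_high (x := x) (by simpa using hx)).reverse

lemma HasZigzag.concat_low {a : Bool} {w : List ℕ} (h : HasZigzag a false w) {x : ℕ}
    (hx : ∀ y ∈ w, x < y) : HasZigzag a true (w ++ [x]) := by
  simpa using (h.reverse.cons_low (x := x) (by simpa using hx)).reverse

lemma HasZigzag.isAlternating {a b : Bool} {w : List ℕ} (h : HasZigzag a b w) :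
    IsAlternating w := by
  obtain ⟨T, -, hT, rfl, -⟩ := h
  exact hT.isAlternating

/-- A low letter `b` is attached to the high end of a word or of its reversal. -/
def attach (b : ℕ) (c : Bool) (w : List ℕ) : List ℕ := bif c then w ++ [b] else b :: w.reverse

/-- Three high letters are attached to a word. -/
def wrap (x y z : ℕ) (i : Fin 3) (v : List ℕ) : List ℕ :=
  ![y :: z :: (v ++ [x]), x :: y :: (v ++ [z]), x :: z :: (v ++ [y])] i

lemma wrap_injective {x y z : ℕ} (hxy : x < y) (hyz : y < z) {i j : Fin 3} {v w : List ℕ}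
    (h : wrap x y z i v = wrap x y z j w) : i = j ∧ v = w := by
  fin_cases i <;> fin_cases j <;> simp [wrap] at h ⊢ <;> first | exact h | omega

lemma attach_injective {b : ℕ} {c d : Bool} {v w : List ℕ} (hv : v ≠ []) (hw : w ≠ [])
    (hbv : b ∉ v) (hbw : b ∉ w) (h : attach b c v = attach b d w) : c = d ∧ v = w := by
  obtain ⟨a, v, rfl⟩ := List.exists_cons_of_ne_nil hv
  obtain ⟨a', w, rfl⟩ := List.exists_cons_of_ne_nil hw
  cases c <;> cases d <;> simp_all [attach]

/-- There is a tree with leaves labeled bijectively by `s, …, s + m - 1` with at least `c`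
alternating words with low left end and high right end. -/
def Rich (s m c : ℕ) : Prop :=
  ∃ (t : BTree) (F : Finset (List ℕ)), t.leaves.Perm (List.range' s m) ∧ c ≤ F.card ∧
    ∀ w ∈ F, w ∈ t.words ∧ HasZigzag true false w

lemma rich_two (s : ℕ) : Rich s 2 1 := by
  refine ⟨.node (.leaf s) (.leaf (s + 1)), {[s, s + 1]}, .refl _, le_rfl, fun w hw => ?_⟩
  rw [Finset.mem_singleton.1 hw]
  refine ⟨append_mem_words (w := [s]) (Finset.mem_singleton_self _) _,
    [(true, s), (false, s + 1)], by simp, ?_, rfl, rfl, rfl⟩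
  simp [Zigzag, joins, blt]

lemma rich_four (s : ℕ) : Rich s 4 1 := by
  refine ⟨.node (.node (.node (.leaf s) (.leaf (s + 2))) (.leaf (s + 1))) (.leaf (s + 3)),
    {[s, s + 2, s + 1, s + 3]}, ?_, le_rfl, fun w hw => ?_⟩
  · exact .cons _ (.swap _ _ _)
  · rw [Finset.mem_singleton.1 hw]
    refine ⟨append_mem_words (append_mem_words (append_mem_words (w := [s])
      (Finset.mem_singleton_self _) _) _) _,
      [(true, s), (false, s + 2), (true, s + 1), (false, s + 3)], by simp, ?_, rfl, rfl, rfl⟩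
    simp [Zigzag, joins, blt]

/-- Adding a lowest leaf and three highest leaves multiplies the number of words by six. -/
lemma Rich.add_four {s m c : ℕ} (h : Rich (s + 1) m c) : Rich s (m + 4) (6 * c) := by
  obtain ⟨t, F, ht, hc, hF⟩ := h
  have hmem : ∀ w ∈ F, ∀ y ∈ w, s < y ∧ y < s + 1 + m := by
    intro w hw y hy
    have := (((perm_leaves_of_mem_words (hF w hw).1).trans ht).mem_iff).1 hy
    rw [List.mem_range'_1] at this
    omega
  have hne : ∀ w ∈ F, w ≠ [] := fun w hw => ne_nil_of_mem_words (hF w hw).1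
  set x := s + 1 + m
  refine ⟨.node (.node (.node (.node t (.leaf s)) (.leaf (x + 2))) (.leaf (x + 1))) (.leaf x),
    (F ×ˢ (Finset.univ : Finset (Bool × Fin 3))).image
      fun p => wrap x (x + 1) (x + 2) p.2.2 (attach s p.2.1 p.1), ?_, ?_, ?_⟩
  · have h₁ : List.range' s (m + 4) = s :: (List.range' (s + 1) m ++ [x, x + 1, x + 2]) := by
      rw [show m + 4 = (m + 3) + 1 by rfl, List.range'_succ, ← List.range'_append_1]
      rfl
    rw [h₁]
    simp only [BTree.leaves, List.append_assoc, List.cons_append, List.nil_append]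
    refine (List.perm_middle (a := s)).trans (.cons _ (ht.append ?_))
    exact (List.reverse_perm [x, x + 1, x + 2])
  · rw [Finset.card_image_of_injOn, Finset.card_product]
    · simp
      omega
    · rintro ⟨v, c, i⟩ hv ⟨w, d, j⟩ hw h
      simp only [Finset.coe_product, Set.mem_prod, Finset.mem_coe] at hv hw
      obtain ⟨rfl, h⟩ := wrap_injective (by omega) (by omega) h
      obtain ⟨rfl, rfl⟩ := attach_injective (hne _ hv.1) (hne _ hw.1)
        (fun h => lt_irrefl _ (hmem _ hv.1 _ h).1) (fun h => lt_irrefl _ (hmem _ hw.1 _ h).1) h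
      rfl
  · intro u hu
    obtain ⟨⟨w, c, i⟩, hw, rfl⟩ := Finset.mem_image.1 hu
    replace hw := (Finset.mem_product.1 hw).1
    obtain ⟨hwt, hwz⟩ := hF w hw
    have hv : attach s c w ∈ (BTree.node t (.leaf s)).words ∧
        HasZigzag true true (attach s c w) ∧ ∀ y ∈ attach s c w, y < x := by
      have hlt : ∀ y ∈ w, s < y := fun y hy => (hmem w hw y hy).1
      cases c
      · refine ⟨cons_mem_words (reverse_mem_words hwt) _,
          hwz.reverse.cons_low (by simpa using hlt), ?_⟩
        simp only [attach, cond_false, List.mem_cons, List.mem_reverse]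
        rintro y (rfl | hy)
        · omega
        · exact (hmem w hw y hy).2
      · refine ⟨append_mem_words hwt _, hwz.concat_low hlt, ?_⟩
        simp only [attach, cond_true, List.mem_append, List.mem_singleton]
        rintro y (hy | rfl)
        · exact (hmem w hw y hy).2
        · omega
    generalize attach s c w = v at hv
    obtain ⟨hvt, hvz, hvx⟩ := hv
    fin_cases i
    · refine ⟨append_mem_words (cons_mem_words (cons_mem_words hvt _) _) _,
        (hvz.concat_high hvx).cons_cons (fun y hy => ?_) (Nat.lt_succ_self _)⟩
      simp only [List.mem_append, List.mem_singleton] at hy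
      rcases hy with hy | rfl
      · exact (hvx y hy).trans_le (Nat.le_add_right _ _)
      · omega
    · refine ⟨cons_mem_words (cons_mem_words (append_mem_words hvt _) _) _,
        (hvz.cons_cons (x := x) (y := x + 1) (fun y hy => (hvx y hy).trans (Nat.lt_succ_self _))
          (Nat.lt_succ_self _)).concat_high (x := x + 2) fun y hy => ?_⟩
      simp only [List.mem_cons] at hy
      rcases hy with rfl | rfl | hy
      · omega
      · omega
      · exact (hvx y hy).trans_le (Nat.le_add_right _ _)
    · refine ⟨cons_mem_words (append_mem_words (cons_mem_words hvt _) _) _,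
        (hvz.concat_high (x := x + 1) fun y hy => (hvx y hy).trans (Nat.lt_succ_self _)).cons_cons
          (x := x) (y := x + 2) (fun y hy => ?_) (by omega)⟩
      simp only [List.mem_append, List.mem_singleton] at hy
      rcases hy with hy | rfl
      · exact (hvx y hy).trans_le (Nat.le_add_right _ _)
      · omega

lemma Rich.pow {m : ℕ} (h : ∀ s, Rich s m 1) (k s : ℕ) : Rich s (m + 4 * k) (6 ^ k) := by
  induction k generalizing s with
  | zero => simpa using h s
  | succ k ih =>
    rw [pow_succ', mul_add_one, ← add_assoc]
    exact (ih (s + 1)).add_four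

lemma bddAbove_altCount (n : ℕ) :
    BddAbove {m | ∃ t : BTree, t.leaves.Perm (List.range' 1 n) ∧ m = altCount t} := by
  refine ⟨⌊80 * √6 ^ (n / 2)⌋₊, ?_⟩
  rintro _ ⟨t, ht, rfl⟩
  refine Nat.le_floor ?_
  simpa [ht.length_eq] using altCount_le t

lemma rAlt_le (n : ℕ) : (rAlt n : ℝ) ≤ 80 * √6 ^ (n / 2) := by
  have h : rAlt n ≤ ⌊80 * √6 ^ (n / 2)⌋₊ := by
    refine csSup_le' ?_
    rintro _ ⟨t, ht, rfl⟩
    refine Nat.le_floor ?_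
    simpa [ht.length_eq] using altCount_le t
  exact (Nat.cast_le.2 h).trans (Nat.floor_le (by positivity))

lemma card_le_rAlt {n : ℕ} {t : BTree} (ht : t.leaves.Perm (List.range' 1 n))
    {F : Finset (List ℕ)} (hF : ∀ w ∈ F, w ∈ t.words ∧ IsAlternating w) : F.card ≤ rAlt n :=
  le_trans (Finset.card_le_card fun w hw => Finset.mem_filter.2 (hF w hw))
    (le_csSup (bddAbove_altCount n) ⟨t, ht, rfl⟩)

lemma Rich.le_rAlt {m c : ℕ} (h : Rich 1 m c) : c ≤ rAlt m := by
  obtain ⟨t, F, ht, hc, hF⟩ := h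
  exact hc.trans (card_le_rAlt ht fun w hw => ⟨(hF w hw).1, (hF w hw).2.isAlternating⟩)

lemma Rich.le_rAlt_succ {m c : ℕ} (h : Rich 2 m c) : c ≤ rAlt (m + 1) := by
  obtain ⟨t, F, ht, hc, hF⟩ := h
  rw [← Finset.card_image_of_injective F (List.append_left_injective [1])] at hc
  refine hc.trans (card_le_rAlt (t := .node t (.leaf 1)) ?_ ?_)
  · rw [List.range'_succ]
    exact List.perm_append_comm.trans (ht.cons 1)
  · intro u hu
    obtain ⟨w, hw, rfl⟩ := Finset.mem_image.1 hu
    refine ⟨append_mem_words (hF w hw).1 1, ((hF w hw).2.concat_low fun y hy => ?_).isAlternating⟩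
    have := (((perm_leaves_of_mem_words (hF w hw).1).trans ht).mem_iff).1 hy
    rw [List.mem_range'_1] at this
    omega

lemma pow_le_rAlt {n : ℕ} (hn : 2 ≤ n) : 6 ^ ((n - 2) / 4) ≤ rAlt n := by
  set k := (n - 2) / 4
  obtain h | h | h | h : n = 2 + 4 * k ∨ n = 2 + 4 * k + 1 ∨ n = 4 + 4 * k ∨ n = 4 + 4 * k + 1 := by
    omega
  all_goals rw [h]
  · exact (Rich.pow rich_two k 1).le_rAlt
  · exact (Rich.pow rich_two k 2).le_rAlt_succ
  · exact (Rich.pow rich_four k 1).le_rAlt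
  · exact (Rich.pow rich_four k 2).le_rAlt_succ

/-! ### The growth rate -/

lemma rAlt_le_rpow (n : ℕ) : (rAlt n : ℝ) ≤ 80 * (6 : ℝ) ^ ((n : ℝ) / 4) := by
  refine (rAlt_le n).trans (mul_le_mul_of_nonneg_left ?_ (by norm_num))
  rw [Real.sqrt_eq_rpow, ← Real.rpow_natCast, ← Real.rpow_mul (by norm_num)]
  refine Real.rpow_le_rpow_of_exponent_le (by norm_num) ?_
  have := Nat.cast_div_le (α := ℝ) (m := n) (n := 2)
  push_cast at this
  linarith

lemma rpow_le_rAlt {n : ℕ} (hn : 2 ≤ n) : 1 / 36 * (6 : ℝ) ^ ((n : ℝ) / 4) ≤ rAlt n := by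
  have h₁ : ((6 ^ ((n - 2) / 4) : ℕ) : ℝ) ≤ rAlt n := Nat.cast_le.2 (pow_le_rAlt hn)
  refine le_trans ?_ h₁
  rw [one_div_mul_eq_div, div_le_iff₀ (by norm_num)]
  push_cast
  rw [show (36 : ℝ) = 6 ^ 2 by norm_num, ← pow_add, ← Real.rpow_natCast]
  refine Real.rpow_le_rpow_of_exponent_le (by norm_num) ?_
  have h₂ : n ≤ 4 * ((n - 2) / 4 + 2) := by omega
  have h₃ : (n : ℝ) ≤ 4 * (((n - 2) / 4 + 2 : ℕ) : ℝ) := by exact_mod_cast h₂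
  linarith

lemma tendsto_const_mul_rpow {c : ℝ} (hc : 0 < c) :
    Filter.Tendsto (fun n : ℕ => (c * (6 : ℝ) ^ ((n : ℝ) / 4)) ^ ((n : ℝ)⁻¹)) Filter.atTop
      (nhds ((6 : ℝ) ^ ((1 : ℝ) / 4))) := by
  have h₁ : Filter.Tendsto (fun n : ℕ => c ^ ((n : ℝ)⁻¹)) Filter.atTop (nhds 1) := by
    have := (Real.continuousAt_const_rpow (b := 0) hc.ne').tendsto.comp
      tendsto_inv_atTop_nhds_zero_nat
    simpa [Function.comp_def] using this
  have h₂ := h₁.mul_const ((6 : ℝ) ^ ((1 : ℝ) / 4))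
  rw [one_mul] at h₂
  refine h₂.congr' ?_
  filter_upwards [Filter.eventually_ge_atTop 1] with n hn
  have hn' : (n : ℝ) ≠ 0 := by positivity
  rw [Real.mul_rpow hc.le (by positivity), ← Real.rpow_mul (by norm_num)]
  congr 2
  field_simp

end AltGrowth

/-- `(r_n)^{1/n} → 6^{1/4}` as `n → ∞`. -/
theorem rAlt_growth_rate :
    Filter.Tendsto (fun n : ℕ => (rAlt n : ℝ) ^ ((n : ℝ)⁻¹)) Filter.atTop
      (nhds ((6 : ℝ) ^ ((1 : ℝ) / 4))) := by
  refine tendsto_of_tendsto_of_tendsto_of_le_of_le'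
    (AltGrowth.tendsto_const_mul_rpow (c := 1 / 36) (by norm_num))
    (AltGrowth.tendsto_const_mul_rpow (c := 80) (by norm_num)) ?_ ?_
  · filter_upwards [Filter.eventually_ge_atTop 2] with n hn
    exact Real.rpow_le_rpow (by positivity) (AltGrowth.rpow_le_rAlt hn) (by positivity)
  · exact .of_forall fun n =>
      Real.rpow_le_rpow (by positivity) (AltGrowth.rAlt_le_rpow n) (by positivity)
end
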